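/- arXiv:math/9808018 — 2 statements merged into one kernel-verified Lean document; each statement's English description precedes it below -/
import Mathlib

section
/- For every positive integer n, the number of plane partitions S contained in the 2n×2n×2n box that are cyclically symmetric (i.e., (i,j,k) ∈ S if and only if (j,k,i) ∈ S) and self-complementary (i.e., (i,j,k) ∈ S if and only if (2n-1-i, 2n-1-j, 2n-1-k) ∉ S) equals ( ∏_{i=0}^{n-1} (3i+1)! / (n+i)! )². -/
open Finset

namespace Matrix

/-- Jacobi's complementary minor identity for the lower right block of the adjugate. -/
theorem det_mul_det_adjugate_toBlocks₂₂ {R m k : Type*} [CommRing R] [Fintype m] [DecidableEq m]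
    [Fintype k] [DecidableEq k] (M : Matrix (m ⊕ k) (m ⊕ k) R) :
    M.det * M.adjugate.toBlocks₂₂.det = M.det ^ Fintype.card k * M.toBlocks₁₁.det := by
  have hadj : fromBlocks M.toBlocks₁₁ M.toBlocks₁₂ M.toBlocks₂₁ M.toBlocks₂₂ *
      fromBlocks M.adjugate.toBlocks₁₁ M.adjugate.toBlocks₁₂ M.adjugate.toBlocks₂₁
        M.adjugate.toBlocks₂₂ = M.det • fromBlocks 1 0 0 1 := by
    rw [fromBlocks_toBlocks, fromBlocks_toBlocks, fromBlocks_one, mul_adjugate]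
  rw [fromBlocks_smul, fromBlocks_multiply] at hadj
  obtain ⟨-, h12, -, h22⟩ := fromBlocks_inj.1 hadj
  have key : M * fromBlocks 1 M.adjugate.toBlocks₁₂ 0 M.adjugate.toBlocks₂₂ =
      fromBlocks M.toBlocks₁₁ 0 M.toBlocks₂₁ (M.det • 1) := by
    conv_lhs => arg 1; rw [← M.fromBlocks_toBlocks]
    rw [fromBlocks_multiply, h12, h22]
    simp
  have := congrArg det key
  rwa [det_mul, det_fromBlocks_zero₂₁, det_one, one_mul, det_fromBlocks_zero₁₂, det_smul,
    det_one, mul_one, mul_comm M.toBlocks₁₁.det] at this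

/-- The equivalence sending the two extra indices to the ends of `Fin (n + 2)`. -/
noncomputable def interiorEndsEquiv (n : ℕ) : Fin n ⊕ Fin 2 ≃ Fin (n + 2) :=
  Equiv.ofBijective
    (Sum.elim (fun i => i.succ.castSucc) ![0, Fin.last (n + 1)]) <| by
    rw [Fintype.bijective_iff_injective_and_card]
    refine ⟨?_, by simp⟩
    rintro (i | i) (j | j) h
    · simpa using h
    · fin_cases j <;> simp [Fin.ext_iff] at h; omega
    · fin_cases i <;> simp [Fin.ext_iff] at h; omega
    · fin_cases i <;> fin_cases j <;> simp [Fin.ext_iff] at h ⊢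

/-- The Desnanot–Jacobi identity (Dodgson condensation). -/
theorem det_mul_det_interior {R : Type*} [CommRing R] {n : ℕ}
    (M : Matrix (Fin (n + 2)) (Fin (n + 2)) R) :
    M.det * (M.submatrix (fun i : Fin n => i.succ.castSucc) (fun i => i.succ.castSucc)).det =
      (M.submatrix Fin.succ Fin.succ).det * (M.submatrix Fin.castSucc Fin.castSucc).det -
        (M.submatrix Fin.succ Fin.castSucc).det * (M.submatrix Fin.castSucc Fin.succ).det := by
  have generic : ∀ {S : Type _} [CommRing S] [IsDomain S]
    (N : Matrix (Fin (n + 2)) (Fin (n + 2)) S),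
      N.det ≠ 0 →
      N.det * (N.submatrix (fun i : Fin n => i.succ.castSucc) (fun i => i.succ.castSucc)).det =
      (N.submatrix Fin.succ Fin.succ).det * (N.submatrix Fin.castSucc Fin.castSucc).det -
        (N.submatrix Fin.succ Fin.castSucc).det * (N.submatrix Fin.castSucc Fin.succ).det := by
    intro S _ _ N hN
    have h := det_mul_det_adjugate_toBlocks₂₂
      (N.submatrix (interiorEndsEquiv n) (interiorEndsEquiv n))
    rw [det_submatrix_equiv_self, adjugate_submatrix_equiv_self, det_fin_two, Fintype.card_fin,
      pow_two, mul_assoc] at h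
    have h' := mul_left_cancel₀ hN h
    simp only [toBlocks₂₂, toBlocks₁₁, submatrix_apply, of_apply, interiorEndsEquiv,
      Equiv.ofBijective_apply, Sum.elim_inr, Sum.elim_inl, cons_val_zero, cons_val_one,
      adjugate_fin_succ_eq_det_submatrix] at h'
    have hs : ((-1 : S) ^ (n + 1)) * (-1) ^ (n + 1) = 1 := by
      rw [← mul_pow]; simp
    simp only [Fin.succAbove_zero, Fin.succAbove_last, Fin.val_zero, Fin.val_last, add_zero,
      zero_add, pow_zero, one_mul] at h'
    have hev : ((-1 : S) ^ (n + 1 + (n + 1))) = 1 := by rw [pow_add, hs]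
    rw [hev] at h'
    have hc : (of fun i j : Fin n => N i.succ.castSucc j.succ.castSucc) =
      N.submatrix (fun i : Fin n => i.succ.castSucc) (fun i => i.succ.castSucc) := rfl
    rw [hc] at h'
    rw [← h']
    linear_combination (-(N.submatrix Fin.succ Fin.castSucc).det *
      (N.submatrix Fin.castSucc Fin.succ).det) * hs
  have h := generic (mvPolynomialX (Fin (n + 2)) (Fin (n + 2)) ℤ)
    (det_mvPolynomialX_ne_zero _ _)
  have h2 := congrArg (MvPolynomial.eval₂Hom (Int.castRingHom R) fun p : _ × _ => M p.1 p.2) h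
  have hM : (MvPolynomial.eval₂Hom (Int.castRingHom R) fun p : _ × _ => M p.1 p.2).mapMatrix
    (mvPolynomialX (Fin (n + 2)) (Fin (n + 2)) ℤ) = M := by ext i j; simp
  simp only [map_mul, map_sub, RingHom.map_det, RingHom.mapMatrix_apply, ← submatrix_map] at h2
  rw [RingHom.mapMatrix_apply] at hM
  rwa [hM] at h2

end Matrix

/-- The reciprocal factorial, extended by zero to negative integers. -/
noncomputable def invFactorial (z : ℤ) : ℚ := if z < 0 then 0 else 1 / (z.toNat.factorial : ℚ)

theorem invFactorial_of_neg {z : ℤ} (hz : z < 0) : invFactorial z = 0 := if_pos hz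

theorem invFactorial_natCast (k : ℕ) : invFactorial k = 1 / (k.factorial : ℚ) := by
  simp [invFactorial]

/-- The Andrews–Mills–Robbins–Rumsey matrix. -/
noncomputable def binomialMatrix (n : ℕ) (x y : ℤ) : Matrix (Fin n) (Fin n) ℚ :=
  Matrix.of fun i j => ((x + y + i + j - 1).toNat.factorial : ℚ) *
    invFactorial (x + 2 * i - j) * invFactorial (y + 2 * j - i)

/-- The ratio of consecutive determinants of `binomialMatrix`. -/
noncomputable def binomialRatio (n x y : ℕ) : ℚ :=
  (n.factorial * (x + y + n - 1).factorial * (2 * x + y + 2 * n).ascFactorial n *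
    (x + 2 * y + 2 * n).ascFactorial n) / ((x + 2 * n).factorial * (y + 2 * n).factorial)

theorem binomialRatio_pos (n x y : ℕ) (h : 0 < x + y) : 0 < binomialRatio n x y := by
  unfold binomialRatio
  obtain ⟨a, ha⟩ : ∃ a, 2 * x + y + 2 * n = a + 1 := ⟨2 * x + y + 2 * n - 1, by omega⟩
  obtain ⟨b, hb⟩ : ∃ b, x + 2 * y + 2 * n = b + 1 := ⟨x + 2 * y + 2 * n - 1, by omega⟩
  rw [ha, hb]
  have := Nat.ascFactorial_pos a n
  have := Nat.ascFactorial_pos b n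
  positivity

theorem binomialRatio_eq {n x y s a b u v : ℕ} (hs : x + y + n = s + 1)
    (ha : 2 * x + y + 2 * n = a) (hb : x + 2 * y + 2 * n = b) (hu : x + 2 * n = u)
    (hv : y + 2 * n = v) :
    binomialRatio n x y = (n.factorial * s.factorial * a.ascFactorial n * b.ascFactorial n) /
      (u.factorial * v.factorial) := by
  rw [binomialRatio, ha, hb, hu, hv, hs, Nat.add_sub_cancel]

theorem binomialRatio_prod_shift (n x y : ℕ) :
    (∏ i ∈ range (n + 1), binomialRatio i (x + 3) y) *
        (∏ i ∈ range (n + 1), binomialRatio i x (y + 3)) *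
        ((x + 2 * n + 3).factorial * (y + 2 * n + 3).factorial) =
      (∏ i ∈ range (n + 1), binomialRatio i (x + 1) (y + 1)) *
        (∏ i ∈ range n, binomialRatio i (x + 2) (y + 2)) *
        (n.factorial * (x + y + 2) * (x + y + n + 2).factorial *
          (2 * x + y + 2 * n + 6).ascFactorial n * (x + 2 * y + 2 * n + 6).ascFactorial n *
          (x + 1) * (y + 1)) := by
  induction n with
  | zero =>
    simp [binomialRatio, Nat.factorial_succ, add_assoc]
    have h1 : (x + y + 2).factorial = (x + y + 2) * (x + y + 1).factorial := rfl
    rw [show x + (3 + y) - 1 = x + y + 2 by omega, show x + (1 + (y + 1)) - 1 = x + y + 1 by omega,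
      h1]
    push_cast
    field_simp
    ring
  | succ n ih =>
    rw [prod_range_succ, prod_range_succ (fun i => binomialRatio i x (y + 3)),
      prod_range_succ (fun i => binomialRatio i (x + 1) (y + 1)),
      prod_range_succ (fun i => binomialRatio i (x + 2) (y + 2)),
      binomialRatio_eq (n := n + 1) (x := x + 3) (y := y) (s := x + y + n + 3)
        (a := 2 * x + y + 2 * n + 8) (b := x + 2 * y + 2 * n + 5) (u := x + 2 * n + 5)
        (v := y + 2 * n + 2) (by ring) (by ring) (by ring) (by ring) (by ring),
      binomialRatio_eq (n := n + 1) (x := x) (y := y + 3) (s := x + y + n + 3)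
        (a := 2 * x + y + 2 * n + 5) (b := x + 2 * y + 2 * n + 8) (u := x + 2 * n + 2)
        (v := y + 2 * n + 5) (by ring) (by ring) (by ring) (by ring) (by ring),
      binomialRatio_eq (n := n + 1) (x := x + 1) (y := y + 1) (s := x + y + n + 2)
        (a := 2 * x + y + 2 * n + 5) (b := x + 2 * y + 2 * n + 5) (u := x + 2 * n + 3)
        (v := y + 2 * n + 3) (by ring) (by ring) (by ring) (by ring) (by ring),
      binomialRatio_eq (n := n) (x := x + 2) (y := y + 2) (s := x + y + n + 3)
        (a := 2 * x + y + 2 * n + 6) (b := x + 2 * y + 2 * n + 6) (u := x + 2 * n + 2)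
        (v := y + 2 * n + 2) (by ring) (by ring) (by ring) (by ring) (by ring)]
    rw [show x + 2 * (n + 1) + 3 = x + 2 * n + 5 by ring,
      show y + 2 * (n + 1) + 3 = y + 2 * n + 5 by ring,
      show x + y + (n + 1) + 2 = x + y + n + 3 by ring,
      show 2 * x + y + 2 * (n + 1) + 6 = 2 * x + y + 2 * n + 8 by ring,
      show x + 2 * y + 2 * (n + 1) + 6 = x + 2 * y + 2 * n + 8 by ring]
    generalize (∏ i ∈ range (n + 1), binomialRatio i (x + 3) y) = P₁ at *
    generalize (∏ i ∈ range (n + 1), binomialRatio i x (y + 3)) = P₂ at *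
    generalize (∏ i ∈ range (n + 1), binomialRatio i (x + 1) (y + 1)) = P₃ at *
    generalize (∏ i ∈ range n, binomialRatio i (x + 2) (y + 2)) = P₄ at *
    generalize (2 * x + y + 2 * n + 8).ascFactorial (n + 1) = A₈ at *
    generalize (2 * x + y + 2 * n + 5).ascFactorial (n + 1) = A₅ at *
    generalize (2 * x + y + 2 * n + 6).ascFactorial n = A₆ at *
    generalize (x + 2 * y + 2 * n + 8).ascFactorial (n + 1) = B₈ at *
    generalize (x + 2 * y + 2 * n + 5).ascFactorial (n + 1) = B₅ at *
    generalize (x + 2 * y + 2 * n + 6).ascFactorial n = B₆ at *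
    have f := fun k : ℕ => (Nat.cast_ne_zero (R := ℚ)).2 (Nat.factorial_ne_zero k)
    have f1 := f (x + 2 * n + 5)
    have f2 := f (y + 2 * n + 5)
    have f3 := f (x + 2 * n + 3)
    have f4 := f (y + 2 * n + 3)
    have f5 := f (x + 2 * n + 2)
    have f6 := f (y + 2 * n + 2)
    generalize ((x + 2 * n + 5).factorial : ℚ) = a at *
    generalize ((y + 2 * n + 5).factorial : ℚ) = b at *
    generalize ((x + 2 * n + 3).factorial : ℚ) = c at *
    generalize ((y + 2 * n + 3).factorial : ℚ) = d at *
    generalize ((x + 2 * n + 2).factorial : ℚ) = g at *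
    generalize ((y + 2 * n + 2).factorial : ℚ) = h at *
    generalize ((x + y + n + 3).factorial : ℚ) = k at *
    generalize ((x + y + n + 2).factorial : ℚ) = l at *
    generalize ((n + 1).factorial : ℚ) = o at *
    field_simp
    linear_combination (o ^ 2 * k ^ 2 * A₈ * B₅ * A₅ * B₈) * ih

theorem binomialRatio_succ (n x y : ℕ) :
    binomialRatio (n + 1) x y * ((x + 2 * n + 2).factorial * (y + 2 * n + 2).factorial) =
      binomialRatio n (x + 1) (y + 1) * ((x + 2 * n + 2).factorial * (y + 2 * n + 2).factorial)
        - (n.factorial * (x + y) * (x + y + n).factorial *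
          (2 * x + y + 2 * n + 3).ascFactorial n * (x + 2 * y + 2 * n + 3).ascFactorial n *
          x * y) := by
  have hasc : ∀ k : ℕ, k.ascFactorial (n + 1) = k * (k + 1).ascFactorial n := fun k => by
    rw [Nat.ascFactorial_succ, Nat.succ_ascFactorial]
  rw [binomialRatio_eq (n := n + 1) (x := x) (y := y) (s := x + y + n)
        (a := 2 * x + y + 2 * n + 2) (b := x + 2 * y + 2 * n + 2) (u := x + 2 * n + 2)
        (v := y + 2 * n + 2) (by ring) (by ring) (by ring) (by ring) (by ring),
      binomialRatio_eq (n := n) (x := x + 1) (y := y + 1) (s := x + y + n + 1)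
        (a := 2 * x + y + 2 * n + 3) (b := x + 2 * y + 2 * n + 3) (u := x + 2 * n + 1)
        (v := y + 2 * n + 1) (by ring) (by ring) (by ring) (by ring) (by ring),
      hasc, hasc, Nat.factorial_succ (x + 2 * n + 1), Nat.factorial_succ (y + 2 * n + 1),
      Nat.factorial_succ n, Nat.factorial_succ (x + y + n)]
  push_cast
  field_simp
  ring

/-- The determinant evaluation of Andrews and of Mills, Robbins and Rumsey. -/
theorem det_binomialMatrix (n x y : ℕ) (h : 0 < x + y) :
    (binomialMatrix n x y).det = ∏ i ∈ range n, binomialRatio i x y := by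
  induction n using Nat.twoStepInduction generalizing x y with
  | zero => simp
  | one =>
    simp [binomialMatrix, binomialRatio, invFactorial_natCast]
    field_simp
    norm_cast
  | more n ih ih' =>
    have dj := (binomialMatrix (n + 2) x y).det_mul_det_interior
    have sub : ∀ (k l : ℕ) (p q : ℤ) (r c : Fin k → Fin l),
        (∃ d e : ℤ, (∀ i, ((r i : ℕ) : ℤ) = i + d) ∧ (∀ i, ((c i : ℕ) : ℤ) = i + e) ∧
          p = x + 2 * d - e ∧ q = y + 2 * e - d) →
        (binomialMatrix l x y).submatrix r c = binomialMatrix k p q := by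
      rintro k l p q r c ⟨d, e, hr, hc, rfl, rfl⟩
      ext i j
      simp only [binomialMatrix, Matrix.submatrix_apply, Matrix.of_apply, hr, hc]
      rw [show (x + y + (i + d) + (j + e) - 1 : ℤ) =
          (x + 2 * d - e) + (y + 2 * e - d) + i + j - 1 by ring,
        show (x + 2 * (i + d) - (j + e) : ℤ) = (x + 2 * d - e) + 2 * i - j by ring,
        show (y + 2 * (j + e) - (i + d) : ℤ) = (y + 2 * e - d) + 2 * j - i by ring]
    rw [sub n (n + 2) ((x + 1 : ℕ) : ℤ) ((y + 1 : ℕ) : ℤ) _ _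
        ⟨1, 1, by simp, by simp, by push_cast; ring, by push_cast; ring⟩,
      sub (n + 1) (n + 2) ((x + 1 : ℕ) : ℤ) ((y + 1 : ℕ) : ℤ) Fin.succ Fin.succ
        ⟨1, 1, by simp, by simp, by push_cast; ring, by push_cast; ring⟩,
      sub (n + 1) (n + 2) x y Fin.castSucc Fin.castSucc
        ⟨0, 0, by simp, by simp, by ring, by ring⟩,
      sub (n + 1) (n + 2) (x + 2) (y - 1) Fin.succ Fin.castSucc
        ⟨1, 0, by simp, by simp, by ring, by ring⟩,
      sub (n + 1) (n + 2) (x - 1) (y + 2) Fin.castSucc Fin.succ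
        ⟨0, 1, by simp, by simp, by ring, by ring⟩,
      ih _ _ (by omega), ih' _ _ (by omega), ih' _ _ h, prod_range_succ] at dj
    have hne : (∏ i ∈ range n, binomialRatio i (x + 1) (y + 1)) ≠ 0 :=
      prod_ne_zero_iff.2 fun i _ => (binomialRatio_pos _ _ _ (by omega)).ne'
    rw [prod_range_succ]
    apply mul_right_cancel₀ hne
    rw [dj]
    have hr := binomialRatio_succ n x y
    have hf : (((x + 2 * n + 2).factorial * (y + 2 * n + 2).factorial : ℕ) : ℚ) ≠ 0 := by
      positivity
    push_cast at hf
    apply mul_right_cancel₀ hf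
    have prod : (binomialMatrix (n + 1) (x + 2) (y - 1)).det *
        (binomialMatrix (n + 1) (x - 1) (y + 2)).det *
        ((x + 2 * n + 2).factorial * (y + 2 * n + 2).factorial) =
      (∏ i ∈ range (n + 1), binomialRatio i x y) *
        (∏ i ∈ range n, binomialRatio i (x + 1) (y + 1)) *
        (n.factorial * (x + y) * (x + y + n).factorial *
          (2 * x + y + 2 * n + 3).ascFactorial n * (x + 2 * y + 2 * n + 3).ascFactorial n *
          x * y) := by
      rcases x with _ | x
      · rw [Matrix.det_eq_zero_of_row_eq_zero (A := binomialMatrix (n + 1) _ (y + 2)) 0]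
        · simp
        · intro j
          simp only [binomialMatrix, Matrix.of_apply]
          rw [invFactorial_of_neg (z := _ - (j : ℤ)) (by push_cast; simp; omega)]
          simp
      rcases y with _ | y
      · rw [Matrix.det_eq_zero_of_column_eq_zero (A := binomialMatrix (n + 1) (_ + 2) _) 0]
        · simp
        · intro j
          simp only [binomialMatrix, Matrix.of_apply]
          rw [invFactorial_of_neg (z := _ - (j : ℤ)) (by push_cast; simp; omega)]
          simp
      have e1 : (((x + 1 : ℕ) : ℤ) + 2) = ((x + 3 : ℕ) : ℤ) := by push_cast; ring
      have e2 : (((y + 1 : ℕ) : ℤ) + 2) = ((y + 3 : ℕ) : ℤ) := by push_cast; ring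
      have e3 : (((x + 1 : ℕ) : ℤ) - 1) = (x : ℤ) := by push_cast; ring
      have e4 : (((y + 1 : ℕ) : ℤ) - 1) = (y : ℤ) := by push_cast; ring
      rw [e1, e2, e3, e4, ih' _ _ (by omega), ih' _ _ (by omega)]
      have := binomialRatio_prod_shift n x y
      rw [show x + 1 + 2 * n + 2 = x + 2 * n + 3 by ring,
        show y + 1 + 2 * n + 2 = y + 2 * n + 3 by ring,
        show x + 1 + (y + 1) + n = x + y + n + 2 by ring,
        show 2 * (x + 1) + (y + 1) + 2 * n + 3 = 2 * x + y + 2 * n + 6 by ring,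
        show x + 1 + 2 * (y + 1) + 2 * n + 3 = x + 2 * y + 2 * n + 6 by ring]
      push_cast
      linear_combination this
    rw [prod_range_succ] at prod ⊢
    linear_combination -prod - (∏ i ∈ range n, binomialRatio i x y) * binomialRatio n x y *
      (∏ i ∈ range n, binomialRatio i (x + 1) (y + 1)) * hr

/-- The rows interlacing with a given row of bits: `D` marks a vector pending from the left and `δ`
whether one vector is added on the right. -/
def interlacing (δ : Bool) : Bool → List Bool → List (List Bool)
  | true, [] => if δ then [] else [[true]]
  | false, [] => [[δ]]
  | true, u :: us => (interlacing δ u us).map (true :: ·)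
  | false, false :: us => (interlacing δ false us).map (false :: ·)
  | false, true :: us =>
      (interlacing δ false us).map (true :: ·) ++ (interlacing δ true us).map (false :: ·)

/-- The rows that can follow a given row of bits. -/
def nextRows (us : List Bool) : List (List Bool) :=
  interlacing false false us ++ interlacing true true us

theorem length_and_count_of_mem_interlacing {δ D : Bool} {us vs : List Bool}
    (h : vs ∈ interlacing δ D us) :
    vs.length = us.length + 1 ∧ vs.count true = us.count true + D.toNat + δ.toNat := by
  induction us generalizing D vs with
  | nil => cases δ <;> cases D <;> simp [interlacing] at h <;> subst h <;> simp
  | cons u us ih =>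
    cases D <;> cases u <;> simp [interlacing] at h
    · obtain ⟨a, ha, rfl⟩ := h
      simpa using ih ha
    · obtain ⟨a, ha, rfl⟩ | ⟨a, ha, rfl⟩ := h
      · have := ih ha
        simp at this ⊢; omega
      · have := ih ha
        simp at this ⊢; omega
    · obtain ⟨a, ha, rfl⟩ := h
      have := ih ha
      simp at this ⊢; omega
    · obtain ⟨a, ha, rfl⟩ := h
      have := ih ha
      simp at this ⊢; omega

theorem nodup_interlacing (δ D : Bool) (us : List Bool) : (interlacing δ D us).Nodup := by
  have inj : ∀ b : Bool, Function.Injective (List.cons b) := fun b => List.cons_injective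
  induction us generalizing D with
  | nil => cases δ <;> cases D <;> simp [interlacing]
  | cons u us ih =>
    cases D <;> cases u <;> simp only [interlacing]
    · exact (ih _).map (inj _)
    · refine ((ih _).map (inj _)).append ((ih _).map (inj _)) ?_
      simp [List.disjoint_left]
    · exact (ih _).map (inj _)
    · exact (ih _).map (inj _)

theorem nodup_nextRows (us : List Bool) : (nextRows us).Nodup := by
  refine (nodup_interlacing _ _ _).append (nodup_interlacing _ _ _) ?_
  rw [List.disjoint_left]
  intro a ha hb
  have h1 := (length_and_count_of_mem_interlacing ha).2
  have h2 := (length_and_count_of_mem_interlacing hb).2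
  simp at h1 h2
  omega

open Classical in
/-- The sequences of rows of length at most `H`, each following the previous one. -/
noncomputable def rowChains : ℕ → Finset (ℕ → List Bool)
  | 0 => {fun _ => []}
  | H + 1 => (rowChains H).biUnion fun c =>
      (nextRows (c H)).toFinset.map
        ⟨Function.update c (H + 1), Function.update_injective c (H + 1)⟩

theorem mem_rowChains {H : ℕ} {c : ℕ → List Bool} :
    c ∈ rowChains H ↔
      c 0 = [] ∧ (∀ h < H, c (h + 1) ∈ nextRows (c h)) ∧ ∀ h, H < h → c h = [] := by
  induction H generalizing c with
  | zero =>
    simp only [rowChains, Finset.mem_singleton]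
    constructor
    · rintro rfl; simp
    · rintro ⟨h0, -, h⟩
      funext k
      rcases Nat.eq_zero_or_pos k with rfl | hk
      exacts [h0, h k hk]
  | succ H ih =>
    simp only [rowChains, mem_biUnion, Finset.mem_map, List.mem_toFinset,
      Function.Embedding.coeFn_mk]
    constructor
    · rintro ⟨c, hc, us, hus, rfl⟩
      obtain ⟨h0, h1, h2⟩ := ih.1 hc
      refine ⟨by simpa using h0, fun h hh => ?_, fun h hh => ?_⟩
      · rcases Nat.lt_succ_iff_lt_or_eq.1 hh with hh | rfl
        · rw [Function.update_of_ne (by omega), Function.update_of_ne (by omega)]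
          exact h1 h hh
        · rw [Function.update_self, Function.update_of_ne (by omega)]
          exact hus
      · rw [Function.update_of_ne (by omega)]
        exact h2 h (by omega)
    · rintro ⟨h0, h1, h2⟩
      refine ⟨Function.update c (H + 1) [], ih.2 ⟨by simpa using h0, fun h hh => ?_,
        fun h hh => ?_⟩, c (H + 1), ?_, by simp⟩
      · rw [Function.update_of_ne (by omega), Function.update_of_ne (by omega)]
        exact h1 h (by omega)
      · rcases eq_or_ne h (H + 1) with rfl | hne
        · simp
        · rw [Function.update_of_ne hne]
          exact h2 h (by omega)
      · rw [Function.update_of_ne (by omega)]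
        exact h1 H (by omega)

theorem length_of_mem_rowChains_of_le {H : ℕ} {c : ℕ → List Bool} (hc : c ∈ rowChains H) :
    ∀ h ≤ H, (c h).length = h := by
  obtain ⟨h0, h1, -⟩ := mem_rowChains.1 hc
  intro h
  induction h with
  | zero => simp [h0]
  | succ h ih =>
    intro hh
    have := h1 h (by omega)
    rw [nextRows, List.mem_append] at this
    rcases this with hm | hm <;>
      rw [(length_and_count_of_mem_interlacing hm).1, ih (by omega)]

theorem length_of_mem_rowChains {H : ℕ} {c : ℕ → List Bool} (hc : c ∈ rowChains H) :
    (c H).length = H :=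
  length_of_mem_rowChains_of_le hc H le_rfl

theorem sum_rowChains_succ {A : Type*} [AddCommMonoid A] (H : ℕ) (F : List Bool → A) :
    ∑ c ∈ rowChains (H + 1), F (c (H + 1)) =
      ∑ c ∈ rowChains H, ((nextRows (c H)).map F).sum := by
  classical
  rw [rowChains, sum_biUnion]
  · refine sum_congr rfl fun c _ => ?_
    rw [sum_map]
    simp only [Function.Embedding.coeFn_mk, Function.update_self]
    exact List.sum_toFinset F (nodup_nextRows _)
  · intro c hc c' hc' hne
    simp only [Function.onFun]
    rw [Finset.disjoint_left]
    intro d hd hd'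
    simp only [Finset.mem_map, List.mem_toFinset, Function.Embedding.coeFn_mk] at hd hd'
    obtain ⟨us, -, rfl⟩ := hd
    obtain ⟨us', -, h⟩ := hd'
    apply hne
    funext k
    rcases eq_or_ne k (H + 1) with rfl | hk
    · rw [(mem_rowChains.1 hc).2.2 _ (by omega), (mem_rowChains.1 hc').2.2 _ (by omega)]
    · simpa [hk] using (congrFun h k).symm

section ExteriorAlgebra

variable {R M : Type*} [CommRing R] [AddCommGroup M] [Module R M]

open ExteriorAlgebra

/-- The exterior product of the vectors `v i` selected by a row of bits. -/
noncomputable def rowWedge (v : ℕ → M) : List Bool → ExteriorAlgebra R M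
  | [] => 1
  | true :: us => ι R (v 0) * rowWedge (fun i => v (i + 1)) us
  | false :: us => rowWedge (fun i => v (i + 1)) us

theorem sum_rowWedge_interlacing (δ D : Bool) (us : List Bool) (v v' : ℕ → M)
    (h : ∀ i < us.length, v i = v' i + v' (i + 1)) :
    ((interlacing δ D us).map (rowWedge (R := R) v')).sum =
      (if D then ι R (v' 0) else 1) * rowWedge v us *
        (if δ then ι R (v' us.length) else 1) := by
  induction us generalizing D v v' with
  | nil => cases δ <;> cases D <;> simp [interlacing, rowWedge]
  | cons u us ih =>
    have ih' := fun D => ih D (fun i => v (i + 1)) (fun i => v' (i + 1))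
      (fun i hi => h (i + 1) (by simpa using hi))
    have h0 : v 0 = v' 0 + v' 1 := h 0 (by simp)
    cases D <;> cases u <;>
      simp only [interlacing, List.map_append, List.map_map, Function.comp_def, List.sum_append,
        List.sum_map_mul_left, ih', List.length_cons, rowWedge, if_true, if_false, one_mul,
        zero_add, h0,
        Bool.false_eq_true, map_add, add_mul, mul_add, ← mul_assoc, ι_sq_zero, zero_mul]

theorem ι_mul_ι_mem_center (x y : M) :
    ι R x * ι R y ∈ Subalgebra.center R (ExteriorAlgebra R M) := by
  rw [Subalgebra.mem_center_iff]
  have swap : ∀ a b : M, ι R a * ι R b = -(ι R b * ι R a) := fun a b =>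
    eq_neg_of_add_eq_zero_left (ι_add_mul_swap a b)
  intro b
  induction b using ExteriorAlgebra.induction with
  | algebraMap r => exact Algebra.commutes _ _
  | ι z =>
    rw [← mul_assoc, swap z x, neg_mul, mul_assoc, swap z y, mul_neg, neg_neg, mul_assoc]
  | mul a b ha hb => rw [mul_assoc, hb, ← mul_assoc, ha, mul_assoc]
  | add a b ha hb => rw [add_mul, ha, hb, mul_add]

/-- The product of two vectors, as an element of the centre of the exterior algebra. -/
noncomputable def centralProduct (x y : M) : Subalgebra.center R (ExteriorAlgebra R M) :=
  ⟨ι R x * ι R y, ι_mul_ι_mem_center x y⟩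

theorem sum_rowWedge_rowChains (v : ℕ → ℕ → M)
    (hv : ∀ h, ∀ i < h, v h i = v (h + 1) i + v (h + 1) (i + 1)) (H : ℕ) :
    ∑ c ∈ rowChains H, rowWedge (R := R) (v H) (c H) =
      ((∏ h ∈ range H, (1 + centralProduct (R := R) (v (h + 1) 0) (v (h + 1) h)) :
        Subalgebra.center R (ExteriorAlgebra R M)) : ExteriorAlgebra R M) := by
  induction H with
  | zero => simp [rowChains, rowWedge]
  | succ H ih =>
    rw [sum_rowChains_succ, prod_range_succ]
    have step : ∀ c ∈ rowChains H, ((nextRows (c H)).map (rowWedge (R := R) (v (H + 1)))).sum =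
        rowWedge (v H) (c H) + ι R (v (H + 1) 0) * rowWedge (v H) (c H) * ι R (v (H + 1) H) := by
      intro c hc
      rw [nextRows, List.map_append, List.sum_append,
        sum_rowWedge_interlacing _ _ _ (v H) _ (by rw [length_of_mem_rowChains hc]; exact hv H),
        sum_rowWedge_interlacing _ _ _ (v H) _ (by rw [length_of_mem_rowChains hc]; exact hv H),
        length_of_mem_rowChains hc]
      simp
    rw [sum_congr rfl step, sum_add_distrib, ← sum_mul, ← mul_sum, ih]
    set P := ∏ h ∈ range H, (1 + centralProduct (R := R) (v (h + 1) 0) (v (h + 1) h))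
    have := Subalgebra.mem_center_iff.1 P.2 (ι R (v (H + 1) 0))
    rw [this]
    simp [mul_add, centralProduct, mul_assoc]

end ExteriorAlgebra

theorem prod_one_add_eq_exp {A κ : Type*} [CommRing A] [Algebra ℚ A] (s : Finset κ) (w : κ → A)
    (hw : ∀ i ∈ s, w i ^ 2 = 0) : ∏ i ∈ s, (1 + w i) = IsNilpotent.exp (∑ i ∈ s, w i) := by
  classical
  induction s using Finset.induction_on with
  | empty => simp
  | insert a s ha ih =>
    have hs := fun i hi => hw i (mem_insert_of_mem hi)
    rw [prod_insert ha, sum_insert ha, ih hs, IsNilpotent.exp_add_of_commute (Commute.all _ _)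
      ⟨2, hw a (mem_insert_self _ _)⟩ (isNilpotent_sum fun i hi => ⟨2, hs i hi⟩),
      IsNilpotent.exp_eq_sum (hw a (mem_insert_self _ _))]
    simp [sum_range_succ]

section ExteriorAlgebra

open ExteriorAlgebra

theorem centralProduct_sq {R M : Type*} [CommRing R] [AddCommGroup M] [Module R M] (x y : M) :
    centralProduct (R := R) x y ^ 2 = 0 := by
  apply Subtype.ext
  have : ι R y * ι R x = -(ι R x * ι R y) := eq_neg_of_add_eq_zero_left (ι_add_mul_swap y x)
  simp only [centralProduct, MulMemClass.mk_mul_mk, pow_two, ZeroMemClass.coe_zero]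
  rw [mul_assoc, ← mul_assoc (ι R y), this, neg_mul, mul_neg, mul_assoc, ← mul_assoc,
    ← mul_assoc, ι_sq_zero]
  simp

theorem rowWedge_mem_exteriorPower {R M : Type*} [CommRing R] [AddCommGroup M] [Module R M]
    (v : ℕ → M) (us : List Bool) : rowWedge (R := R) v us ∈ ⋀[R]^(us.count true) M := by
  induction us generalizing v with
  | nil => simp [rowWedge]
  | cons u us ih =>
    cases u
    · simpa [rowWedge] using ih _
    · rw [List.count_cons_self, rowWedge, exteriorPower, pow_succ']
      exact Submodule.mul_mem_mul (LinearMap.mem_range_self _ _) (ih _)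

theorem rowWedge_replicate_true {R M : Type*} [CommRing R] [AddCommGroup M] [Module R M]
    (v : ℕ → M) (k : ℕ) :
    rowWedge (R := R) v (List.replicate k true) = ιMulti R k fun i => v i := by
  rw [ιMulti_apply]
  induction k generalizing v with
  | zero => simp [rowWedge]
  | succ k ih =>
    rw [List.replicate_succ, rowWedge, ih, List.ofFn_succ, List.prod_cons]
    rfl

theorem prod_centralProduct_mem_exteriorPower {R M κ : Type*} [CommRing R] [AddCommGroup M]
    [Module R M] (t : Finset κ) (x y : κ → M) :
    ((∏ a ∈ t, centralProduct (R := R) (x a) (y a) :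
      Subalgebra.center R (ExteriorAlgebra R M)) : ExteriorAlgebra R M) ∈
        ⋀[R]^(2 * #t) M := by
  classical
  induction t using Finset.induction_on with
  | empty => simp
  | insert a s ha ih =>
    rw [prod_insert ha, card_insert_of_notMem ha, mul_add, add_comm, exteriorPower, pow_add]
    refine Submodule.mul_mem_mul ?_ ih
    rw [mul_one, pow_two]
    exact Submodule.mul_mem_mul (LinearMap.mem_range_self _ _) (LinearMap.mem_range_self _ _)

/-- The two copies of `Fin n` alternating inside `Fin (2 * n)`. -/
noncomputable def alternatingEquiv (n : ℕ) : Fin n ⊕ Fin n ≃ Fin (2 * n) :=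
  Equiv.ofBijective
    (Sum.elim (fun a => ⟨2 * a, by omega⟩) fun a => ⟨2 * a + 1, by omega⟩) <| by
    rw [Fintype.bijective_iff_injective_and_card]
    refine ⟨?_, by simp [two_mul]⟩
    rintro (a | a) (b | b) h <;> simp [Fin.ext_iff] at h ⊢ <;> omega

@[simp]
theorem alternatingEquiv_inl {n : ℕ} (a : Fin n) :
    (alternatingEquiv n (Sum.inl a) : ℕ) = 2 * a := rfl

@[simp]
theorem alternatingEquiv_inr {n : ℕ} (a : Fin n) :
    (alternatingEquiv n (Sum.inr a) : ℕ) = 2 * a + 1 := rfl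

/-- The determinant, as a linear form on the exterior algebra. -/
noncomputable def detForm (n : ℕ) : ExteriorAlgebra ℚ (Fin n ⊕ Fin n → ℚ) →ₗ[ℚ] ℚ :=
  liftAlternating
    (Pi.single (2 * n) (Matrix.detRowAlternating.domDomCongr (alternatingEquiv n)))

theorem detForm_ιMulti {n : ℕ} (v : Fin (2 * n) → Fin n ⊕ Fin n → ℚ) :
    detForm n (ιMulti ℚ (2 * n) v) = (Matrix.of fun j => v (alternatingEquiv n j)).det := by
  rw [detForm, liftAlternating_apply_ιMulti, Pi.single_eq_same]
  rfl

theorem detForm_eq_zero {n k : ℕ} (hk : k ≠ 2 * n) {z : ExteriorAlgebra ℚ (Fin n ⊕ Fin n → ℚ)}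
    (hz : z ∈ ⋀[ℚ]^k (Fin n ⊕ Fin n → ℚ)) : detForm n z = 0 := by
  rw [← ιMulti_span_fixedDegree] at hz
  induction hz using Submodule.span_induction with
  | mem z hz =>
    obtain ⟨v, rfl⟩ := hz
    rw [detForm, liftAlternating_apply_ιMulti, Pi.single_eq_of_ne hk]
    rfl
  | zero => exact map_zero _
  | add y z _ _ hy hz => rw [map_add, hy, hz, add_zero]
  | smul r z _ hz => rw [map_smul, hz, smul_zero]

theorem detForm_prod_one_add {n : ℕ} (x y : Fin n → Fin n ⊕ Fin n → ℚ) :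
    detForm n (∏ a, (1 + centralProduct (R := ℚ) (x a) (y a)) :
      Subalgebra.center ℚ (ExteriorAlgebra ℚ (Fin n ⊕ Fin n → ℚ))) =
      (Matrix.of (Sum.elim x y)).det := by
  rw [prod_one_add, ← sum_erase_add _ _ (mem_powerset_self _), Subalgebra.coe_add, map_add,
    AddSubmonoidClass.coe_finsetSum, map_sum, sum_eq_zero, zero_add]
  · have : ((∏ a, centralProduct (R := ℚ) (x a) (y a) :
        Subalgebra.center ℚ (ExteriorAlgebra ℚ (Fin n ⊕ Fin n → ℚ))) :
          ExteriorAlgebra ℚ (Fin n ⊕ Fin n → ℚ)) =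
        ιMulti ℚ (2 * n) fun i => Sum.elim x y ((alternatingEquiv n).symm i) := by
      rw [ιMulti_apply, List.ofFn_mul', List.prod_flatten, List.map_ofFn, ← List.prod_ofFn,
        SubmonoidClass.coe_list_prod, List.map_ofFn]
      congr 2
      funext a
      have h0 : (⟨2 * (a : ℕ), by omega⟩ : Fin (2 * n)) = alternatingEquiv n (Sum.inl a) := rfl
      have h1 : (⟨2 * (a : ℕ) + 1, by omega⟩ : Fin (2 * n)) = alternatingEquiv n (Sum.inr a) := rfl
      simp [centralProduct, List.ofFn_succ, h0, h1]
    rw [this, detForm_ιMulti]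
    simp
  · intro t ht
    rw [mem_erase, mem_powerset] at ht
    refine detForm_eq_zero ?_ (prod_centralProduct_mem_exteriorPower t x y)
    have := card_lt_card (ht.2.ssubset_of_ne ht.1)
    simp at this
    omega

theorem sum_mul_ι_mul_ι_eq_zero {M κ : Type*} [AddCommGroup M] [Module ℚ M]
    (s : Finset κ) (x : κ → M) (G : κ → κ → ℚ) (hG : ∀ a b, G a b = G b a) :
    ∑ a ∈ s, ∑ b ∈ s, G a b • (ι ℚ (x a) * ι ℚ (x b)) = 0 := by
  have h : ∑ a ∈ s, ∑ b ∈ s, G a b • (ι ℚ (x a) * ι ℚ (x b)) =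
      -∑ a ∈ s, ∑ b ∈ s, G a b • (ι ℚ (x a) * ι ℚ (x b)) := by
    conv_lhs => rw [sum_comm]
    simp_rw [← sum_neg_distrib]
    refine sum_congr rfl fun a _ => sum_congr rfl fun b _ => ?_
    rw [hG b a, ← smul_neg, eq_neg_of_add_eq_zero_left (ι_add_mul_swap (x b) (x a))]
  have h2 : (2 : ℚ) • ∑ a ∈ s, ∑ b ∈ s, G a b • (ι ℚ (x a) * ι ℚ (x b)) = 0 := by
    rw [two_smul]
    exact add_eq_zero_iff_eq_neg.2 h
  exact (smul_eq_zero.1 h2).resolve_left two_ne_zero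

end ExteriorAlgebra

section ReflectionBasis

open ExteriorAlgebra
open Polynomial (X)
open scoped Polynomial

/-- The symmetric bilinear form on polynomials for which the powers of `X` below `X ^ m` are
orthonormal and the others vanish. -/
noncomputable def coeffPairing (m : ℕ) : ℚ[X] →ₗ[ℚ] ℚ[X] →ₗ[ℚ] ℚ :=
  ∑ j ∈ range m, (LinearMap.mul ℚ ℚ).compl₁₂ (Polynomial.lcoeff ℚ j) (Polynomial.lcoeff ℚ j)

theorem coeffPairing_apply (m : ℕ) (p q : ℚ[X]) :
    coeffPairing m p q = ∑ j ∈ range m, p.coeff j * q.coeff j := by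
  simp [coeffPairing, LinearMap.sum_apply]

theorem coeffPairing_comm (m : ℕ) (p q : ℚ[X]) : coeffPairing m p q = coeffPairing m q p := by
  simp only [coeffPairing_apply, mul_comm]

theorem sum_coeffPairing_mul_coeffPairing {m : ℕ} {p : ℚ[X]} (hp : p.natDegree < m) (q : ℚ[X]) :
    ∑ h ∈ range m, coeffPairing m p (X ^ h) * coeffPairing m q ((1 - X) ^ h) =
      coeffPairing m q (p.comp (1 - X)) := by
  rw [Polynomial.comp, Polynomial.eval₂_eq_sum_range' _ hp, map_sum]
  refine sum_congr rfl fun h hh => ?_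
  rw [← Polynomial.smul_eq_C_mul, map_smul, smul_eq_mul, coeffPairing_apply]
  congr 1
  simp only [Polynomial.coeff_X_pow, mul_ite, mul_one, mul_zero]
  rw [sum_ite_eq' _ _ _, if_pos hh]

/-- The even and the odd polynomials with respect to `X ↦ 1 - X`. -/
noncomputable def reflectionBasis (n : ℕ) : Fin n ⊕ Fin n → ℚ[X] :=
  Sum.elim (fun a => X ^ (a : ℕ) * (1 - X) ^ (a : ℕ))
    fun b => (1 - 2 * X) * (X ^ (b : ℕ) * (1 - X) ^ (b : ℕ))

theorem natDegree_one_sub_X : (1 - X : ℚ[X]).natDegree = 1 := by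
  rw [← neg_sub, Polynomial.natDegree_neg]
  exact Polynomial.natDegree_X_sub_C 1

theorem one_sub_two_mul_X :
    (1 - 2 * X : ℚ[X]) = Polynomial.C (-2) * X + Polynomial.C 1 := by
  rw [Polynomial.C_neg, map_ofNat, Polynomial.C_1]
  ring

theorem natDegree_reflectionBasis {n : ℕ} (j : Fin n ⊕ Fin n) :
    (reflectionBasis n j).natDegree = alternatingEquiv n j := by
  have h0 : (1 - X : ℚ[X]) ≠ 0 := fun h => by
    simpa [h] using natDegree_one_sub_X
  have h2 : (1 - 2 * X : ℚ[X]).natDegree = 1 := by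
    rw [one_sub_two_mul_X]
    exact Polynomial.natDegree_linear (by norm_num)
  have h1 : (1 - 2 * X : ℚ[X]) ≠ 0 := fun h => by simp [h] at h2
  have hX : (X : ℚ[X]) ≠ 0 := Polynomial.X_ne_zero
  rcases j with a | b
  · rw [reflectionBasis, Sum.elim_inl, Polynomial.natDegree_mul (pow_ne_zero _ hX)
      (pow_ne_zero _ h0), Polynomial.natDegree_X_pow, Polynomial.natDegree_pow,
      natDegree_one_sub_X, alternatingEquiv_inl]
    ring
  · rw [reflectionBasis, Sum.elim_inr, Polynomial.natDegree_mul h1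
      (mul_ne_zero (pow_ne_zero _ hX) (pow_ne_zero _ h0)),
      Polynomial.natDegree_mul (pow_ne_zero _ hX)
      (pow_ne_zero _ h0), Polynomial.natDegree_X_pow, Polynomial.natDegree_pow,
      natDegree_one_sub_X, alternatingEquiv_inr, h2]
    ring

theorem reflectionBasis_comp_inl {n : ℕ} (a : Fin n) :
    (reflectionBasis n (Sum.inl a)).comp (1 - X) = reflectionBasis n (Sum.inl a) := by
  simp [reflectionBasis, mul_comm]

theorem reflectionBasis_comp_inr {n : ℕ} (a : Fin n) :
    (reflectionBasis n (Sum.inr a)).comp (1 - X) = -reflectionBasis n (Sum.inr a) := by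
  simp [reflectionBasis]
  ring

/-- The coordinates of a polynomial given by pairing with `reflectionBasis`. -/
noncomputable def reflectionCoords (n : ℕ) : ℚ[X] →ₗ[ℚ] (Fin n ⊕ Fin n → ℚ) :=
  LinearMap.pi fun j => coeffPairing (2 * n) (reflectionBasis n j)

/-- The pairings of even with odd polynomials. -/
noncomputable def evenOddGram (n : ℕ) : Matrix (Fin n) (Fin n) ℚ :=
  Matrix.of fun a b =>
    coeffPairing (2 * n) (reflectionBasis n (Sum.inl a)) (reflectionBasis n (Sum.inr b))

theorem ι_mul_ι_eq_sum {κ : Type*} [Fintype κ] [DecidableEq κ] (u w : κ → ℚ) :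
    ι ℚ u * ι ℚ w =
      ∑ p, ∑ q, (u p * w q) • (ι ℚ (Pi.single p (1 : ℚ)) * ι ℚ (Pi.single q (1 : ℚ))) := by
  have h : ∀ u : κ → ℚ, ι ℚ u = ∑ p, u p • ι ℚ (Pi.single p (1 : ℚ)) := fun u => by
    conv_lhs => rw [← Finset.univ_sum_single u]
    rw [map_sum]
    refine sum_congr rfl fun p _ => ?_
    rw [← map_smul, ← Pi.single_smul, smul_eq_mul, mul_one]
  rw [h u, h w, sum_mul_sum]
  simp only [smul_mul_smul_comm]

theorem sum_centralProduct_reflectionCoords (n : ℕ) :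
    ∑ h ∈ range (2 * n), centralProduct (R := ℚ) (reflectionCoords n (X ^ h))
        (reflectionCoords n ((1 - X) ^ h)) =
      ∑ a, centralProduct (Pi.single (Sum.inl a) (1 : ℚ))
        (Sum.elim 0 fun b => 2 * evenOddGram n a b) := by
  apply Subtype.ext
  rw [AddSubmonoidClass.coe_finsetSum, AddSubmonoidClass.coe_finsetSum]
  simp only [centralProduct]
  have lhs : ∑ h ∈ range (2 * n), ι ℚ (reflectionCoords n (X ^ h)) *
        ι ℚ (reflectionCoords n ((1 - X) ^ h)) =
      ∑ p, ∑ q, coeffPairing (2 * n) (reflectionBasis n q) ((reflectionBasis n p).comp (1 - X)) •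
        (ι ℚ (Pi.single p (1 : ℚ)) * ι ℚ (Pi.single q (1 : ℚ))) := by
    simp_rw [ι_mul_ι_eq_sum (reflectionCoords n _)]
    rw [sum_comm]
    refine sum_congr rfl fun p _ => ?_
    rw [sum_comm]
    refine sum_congr rfl fun q _ => ?_
    rw [← sum_smul, ← sum_coeffPairing_mul_coeffPairing
      (by rw [natDegree_reflectionBasis]; exact Fin.is_lt _)]
    rfl
  have swap : ∀ a b : Fin n,
      ι ℚ (Pi.single (Sum.inr b) (1 : ℚ) : Fin n ⊕ Fin n → ℚ) * ι ℚ (Pi.single (Sum.inl a) 1) =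
        -(ι ℚ (Pi.single (Sum.inl a) 1) * ι ℚ (Pi.single (Sum.inr b) 1)) :=
    fun a b => eq_neg_of_add_eq_zero_left (ι_add_mul_swap _ _)
  rw [lhs, Fintype.sum_sum_type]
  simp only [Fintype.sum_sum_type, sum_add_distrib, reflectionBasis_comp_inl,
    reflectionBasis_comp_inr, map_neg, neg_smul, sum_neg_distrib, swap, smul_neg]
  rw [sum_mul_ι_mul_ι_eq_zero univ
      (fun a => (Pi.single (Sum.inl a) 1 : Fin n ⊕ Fin n → ℚ))
      (fun a b => coeffPairing (2 * n) (reflectionBasis n (Sum.inl b))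
        (reflectionBasis n (Sum.inl a))) fun a b => coeffPairing_comm _ _ _,
    sum_mul_ι_mul_ι_eq_zero univ
      (fun a => (Pi.single (Sum.inr a) 1 : Fin n ⊕ Fin n → ℚ))
      (fun a b => coeffPairing (2 * n) (reflectionBasis n (Sum.inr b))
        (reflectionBasis n (Sum.inr a))) fun a b => coeffPairing_comm _ _ _, add_zero, zero_add,
        neg_neg]
  conv_lhs => arg 2; rw [sum_comm]
  rw [← sum_add_distrib]
  refine sum_congr rfl fun a _ => ?_
  rw [← sum_add_distrib, ι_mul_ι_eq_sum, sum_eq_single (Sum.inl a)]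
  · simp only [Fintype.sum_sum_type, Pi.single_eq_same, one_mul, Sum.elim_inl, Sum.elim_inr,
      Pi.zero_apply, zero_smul, sum_const_zero, zero_add]
    refine sum_congr rfl fun b _ => ?_
    rw [two_mul (evenOddGram n a b), add_smul, evenOddGram, Matrix.of_apply,
      coeffPairing_comm _ (reflectionBasis n (Sum.inr b))]
  · intro p _ hp
    simp [Pi.single_eq_of_ne hp]
  · simp

theorem detForm_prod_one_add_reflectionCoords (n : ℕ) :
    detForm n (∏ h ∈ range (2 * n), (1 + centralProduct (R := ℚ) (reflectionCoords n (X ^ h))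
        (reflectionCoords n ((1 - X) ^ h))) :
          Subalgebra.center ℚ (ExteriorAlgebra ℚ (Fin n ⊕ Fin n → ℚ))) =
      2 ^ n * (evenOddGram n).det := by
  rw [prod_one_add_eq_exp _ _ fun _ _ => centralProduct_sq _ _,
    sum_centralProduct_reflectionCoords, ← prod_one_add_eq_exp _ _ fun _ _ => centralProduct_sq _ _,
    detForm_prod_one_add]
  have : (Matrix.of (Sum.elim (fun a => (Pi.single (Sum.inl a) (1 : ℚ) : Fin n ⊕ Fin n → ℚ))
      fun a => Sum.elim 0 fun b => 2 * evenOddGram n a b)) =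
      Matrix.fromBlocks 1 0 0 ((2 : ℚ) • evenOddGram n) := by
    ext (a | a) (b | b) <;>
      simp [Matrix.one_apply, Pi.single_apply, eq_comm]
  rw [this, Matrix.det_fromBlocks_zero₂₁, Matrix.det_one, one_mul, Matrix.det_smul,
    Fintype.card_fin]

/-- The vector attached to position `i` of row `h`. -/
noncomputable def rowPolynomial (h i : ℕ) : ℚ[X] := X ^ (h - 1 - i) * (1 - X) ^ i

theorem rowPolynomial_eq_add {h i : ℕ} (hi : i < h) :
    rowPolynomial h i = rowPolynomial (h + 1) i + rowPolynomial (h + 1) (i + 1) := by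
  obtain ⟨d, rfl⟩ := Nat.exists_eq_add_of_lt hi
  simp only [rowPolynomial]
  rw [show i + d + 1 - 1 - i = d by omega, show i + d + 1 + 1 - 1 - i = d + 1 by omega,
    show i + d + 1 + 1 - 1 - (i + 1) = d by omega]
  ring

theorem abs_det_rowPolynomial_coeff (m : ℕ) :
    |(Matrix.of fun i j : Fin m => (rowPolynomial m i).coeff j).det| = 1 := by
  have h : ((Matrix.of fun i j : Fin m => (rowPolynomial m i).coeff j).submatrix
      Fin.revPerm id).det = 1 := by
    have e : ∀ i j : Fin m, (Matrix.of fun i j : Fin m => (rowPolynomial m i).coeff j).submatrix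
        Fin.revPerm id i j = (X ^ (i : ℕ) * (1 - X) ^ (m - (i + 1)) : ℚ[X]).coeff j := by
      intro i j
      simp [rowPolynomial, Fin.val_rev, show m - 1 - (m - (i + 1)) = (i : ℕ) by omega]
    rw [Matrix.det_of_isUpperTriangular]
    · refine prod_eq_one fun i _ => ?_
      rw [e, Polynomial.coeff_X_pow_mul', if_pos le_rfl, Nat.sub_self]
      simp [Polynomial.coeff_zero_eq_eval_zero]
    · intro i j hij
      rw [e, Polynomial.coeff_X_pow_mul', if_neg (show ¬(i : ℕ) ≤ j from not_le.2 hij)]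
  rw [Matrix.det_permute] at h
  have h' := congrArg abs h
  rcases Int.units_eq_one_or (Equiv.Perm.sign (Fin.revPerm (n := m))) with hs | hs <;>
    simpa [abs_mul, hs] using h'

theorem abs_det_reflectionBasis_coeff (n : ℕ) :
    |(Matrix.of fun i j : Fin (2 * n) =>
      (reflectionBasis n ((alternatingEquiv n).symm i)).coeff j).det| = 2 ^ n := by
  rw [Matrix.det_of_isLowerTriangular]
  · rw [abs_prod, ← (alternatingEquiv n).prod_comp, Fintype.prod_sum_type]
    have h0 : (1 - X : ℚ[X]).leadingCoeff = -1 := by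
      rw [← neg_sub, Polynomial.leadingCoeff_neg]
      congr 1
      exact Polynomial.leadingCoeff_X_sub_C 1
    have h1 : (1 - 2 * X : ℚ[X]).leadingCoeff = -2 := by
      rw [one_sub_two_mul_X]
      exact Polynomial.leadingCoeff_linear (by norm_num)
    simp only [Matrix.of_apply, Equiv.symm_apply_apply, ← natDegree_reflectionBasis,
      Polynomial.coeff_natDegree]
    simp [reflectionBasis, Polynomial.leadingCoeff_mul, h0, h1, abs_mul]
  · intro i j hij
    rw [Matrix.of_apply]
    apply Polynomial.coeff_eq_zero_of_natDegree_lt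
    rw [natDegree_reflectionBasis, Equiv.apply_symm_apply]
    exact hij

theorem abs_detForm_rowWedge (n : ℕ) :
    |detForm n (rowWedge (fun i => reflectionCoords n (rowPolynomial (2 * n) i))
      (List.replicate (2 * n) true))| = 2 ^ n := by
  have : (Matrix.of fun j => reflectionCoords n (rowPolynomial (2 * n) (alternatingEquiv n j))) =
      ((Matrix.of fun i j : Fin (2 * n) => (rowPolynomial (2 * n) i).coeff j) *
        (Matrix.of fun i j : Fin (2 * n) =>
          (reflectionBasis n ((alternatingEquiv n).symm i)).coeff j).transpose).submatrix
            (alternatingEquiv n) (alternatingEquiv n) := by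
    ext p q
    simp only [reflectionCoords, Matrix.of_apply, LinearMap.pi_apply, coeffPairing_apply,
      Matrix.submatrix_apply, Matrix.mul_apply, Matrix.transpose_apply, Equiv.symm_apply_apply]
    rw [← Fin.sum_univ_eq_sum_range
      (fun j => (reflectionBasis n q).coeff j * (rowPolynomial _ _).coeff j)]
    exact sum_congr rfl fun j _ => mul_comm _ _
  rw [rowWedge_replicate_true, detForm_ιMulti, this, Matrix.det_submatrix_equiv_self,
    Matrix.det_mul, Matrix.det_transpose, abs_mul, abs_det_rowPolynomial_coeff,
    abs_det_reflectionBasis_coeff, one_mul]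

theorem coeff_one_sub_X_pow (k j : ℕ) :
    ((1 - X : ℚ[X]) ^ k).coeff j = (-1) ^ j * (k.choose j : ℚ) := by
  have : (1 - X : ℚ[X]) ^ k = ((1 + X) ^ k).comp (-X) := by
    simp [sub_eq_add_neg]
  rw [this, show (-X : ℚ[X]) = Polynomial.C (-1) * X by simp,
    Polynomial.comp_C_mul_X_coeff, Polynomial.coeff_one_add_X_pow, mul_comm]

theorem coeffPairing_even {m a : ℕ} (ha : 2 * a < m) (p : ℚ[X]) :
    coeffPairing m (X ^ a * (1 - X) ^ a) p = (-1) ^ a * (p * (1 - X) ^ a).coeff (2 * a) := by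
  rw [coeffPairing_apply, Polynomial.coeff_mul,
    Finset.Nat.sum_antidiagonal_eq_sum_range_succ_mk, mul_sum]
  symm
  apply sum_subset_zero_on_sdiff (range_subset_range.2 ha)
  · intro i hi
    simp only [mem_sdiff, mem_range] at hi
    rw [Polynomial.coeff_X_pow_mul', if_pos (by omega), coeff_one_sub_X_pow,
      Nat.choose_eq_zero_of_lt (by omega)]
    simp
  · intro i hi
    rw [mem_range] at hi
    rw [Polynomial.coeff_X_pow_mul', coeff_one_sub_X_pow, coeff_one_sub_X_pow]
    split_ifs with h
    · obtain ⟨d, rfl⟩ := Nat.exists_eq_add_of_le h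
      rw [Nat.add_sub_cancel_left, show 2 * a - (a + d) = a - d by omega,
        Nat.choose_symm (by omega)]
      obtain ⟨e, rfl⟩ : ∃ e, a = d + e := ⟨a - d, by omega⟩
      have : ((-1 : ℚ) ^ e) * (-1) ^ e = 1 := by rw [← mul_pow]; simp
      rw [Nat.add_sub_cancel_left, pow_add]
      linear_combination (-1 : ℚ) ^ d * p.coeff (d + e + d) * ((d + e).choose d) * this
    · rw [Nat.choose_eq_zero_of_lt (by omega)]
      simp

theorem choose_add_two_mul_choose (s t : ℕ) :
    ((s + 1 + t).choose (s + 1) : ℚ) + 2 * (s + 1 + t).choose s =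
      (2 * (s + 1) + t + 1) * (s + 1 + t).factorial * (1 / (s + 1).factorial) *
        (1 / (t + 1).factorial) := by
  have h1 := Nat.add_choose_mul_factorial_mul_factorial (s + 1) t
  have h2 := Nat.add_choose_mul_factorial_mul_factorial s (t + 1)
  rw [← Nat.choose_symm_add] at h1 h2
  rw [show s + (t + 1) = s + 1 + t by ring] at h2
  rw [Nat.factorial_succ s] at h1 ⊢
  rw [Nat.factorial_succ t] at h2 ⊢
  have h1' := congrArg (Nat.cast (R := ℚ)) h1
  have h2' := congrArg (Nat.cast (R := ℚ)) h2
  push_cast at h1' h2' ⊢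
  have := (Nat.cast_ne_zero (R := ℚ)).2 (Nat.factorial_ne_zero s)
  have := (Nat.cast_ne_zero (R := ℚ)).2 (Nat.factorial_ne_zero t)
  field_simp
  linear_combination (t + 1 : ℚ) * h1' + 2 * (s + 1 : ℚ) * h2'

theorem evenOddGram_apply {n : ℕ} (a b : Fin n) :
    evenOddGram n a b =
      (-1) ^ (a : ℕ) * ((-1) ^ (b : ℕ) * ((3 * a + 1) * binomialMatrix n 0 1 a b)) := by
  have e : (1 - 2 * X : ℚ[X]) * (X ^ (b : ℕ) * (1 - X) ^ (b : ℕ)) * (1 - X) ^ (a : ℕ) =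
      X ^ (b : ℕ) * (1 - X) ^ (a + b : ℕ) -
        (2 : ℚ) • (X ^ (b + 1 : ℕ) * (1 - X) ^ (a + b : ℕ)) := by
    rw [Polynomial.smul_eq_C_mul, map_ofNat]
    ring
  simp only [evenOddGram, reflectionBasis, Matrix.of_apply, Sum.elim_inl, Sum.elim_inr]
  rw [coeffPairing_even (by omega), e]
  congr 1
  simp only [Polynomial.coeff_sub, Polynomial.coeff_smul, Polynomial.coeff_X_pow_mul', smul_eq_mul,
    coeff_one_sub_X_pow, binomialMatrix, Matrix.of_apply]
  generalize (a : ℕ) = a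
  generalize (b : ℕ) = b
  have hf : ((0 : ℤ) + 1 + a + b - 1).toNat = a + b := by omega
  rw [hf]
  rcases lt_or_ge (2 * a) b with h | h
  · rw [if_neg (by omega), if_neg (by omega), invFactorial_of_neg (by omega)]
    simp
  have hs : (0 : ℤ) + 2 * a - b = ((2 * a - b : ℕ) : ℤ) := by omega
  have hpow : (-1 : ℚ) ^ (2 * a - b) = (-1) ^ b := by
    rw [neg_one_pow_eq_pow_mod_two, neg_one_pow_eq_pow_mod_two (n := b)]
    congr 1
    omega
  rw [if_pos h, hs, invFactorial_natCast, hpow]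
  rcases lt_or_ge (2 * b + 1) a with h' | h'
  · rw [if_pos (by omega), invFactorial_of_neg (z := _ - _) (by omega),
      Nat.choose_eq_zero_of_lt (by omega), Nat.choose_eq_zero_of_lt (by omega)]
    simp
  have ht : (1 : ℤ) + 2 * b - a = ((2 * b + 1 - a : ℕ) : ℤ) := by omega
  rw [ht, invFactorial_natCast]
  rcases h.eq_or_lt with h0 | h0
  · subst h0
    rw [if_neg (by omega), Nat.sub_self, show 2 * (2 * a) + 1 - a = 3 * a + 1 by omega,
      show a + 2 * a = 3 * a by omega, Nat.factorial_succ]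
    have := (Nat.cast_ne_zero (R := ℚ)).2 (Nat.factorial_ne_zero (3 * a))
    push_cast
    simp
    field_simp
  rw [if_pos (by omega)]
  have hpow' : (-1 : ℚ) ^ (2 * a - (b + 1)) = -(-1) ^ b := by
    rw [← hpow, show 2 * a - b = 2 * a - (b + 1) + 1 by omega, pow_succ]
    ring
  rw [hpow']
  rcases h'.eq_or_lt with h1 | h1
  · subst h1
    rw [Nat.choose_eq_zero_of_lt (by omega),
      show 2 * (2 * b + 1) - (b + 1) = 2 * b + 1 + b by omega,
      Nat.choose_self, show 2 * (2 * b + 1) - b = (2 * b + 1 + b) + 1 by omega, Nat.factorial_succ]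
    have := (Nat.cast_ne_zero (R := ℚ)).2 (Nat.factorial_ne_zero (2 * b + 1 + b))
    push_cast
    simp
    field_simp
    ring
  obtain ⟨s, hs⟩ : ∃ s, 2 * a - (b + 1) = s := ⟨_, rfl⟩
  obtain ⟨t, ht⟩ : ∃ t, 2 * b - a = t := ⟨_, rfl⟩
  have key := choose_add_two_mul_choose s t
  rw [show s + 1 + t = a + b by omega] at key
  have hq : (3 * a + 1 : ℚ) = 2 * (s + 1) + t + 1 := by
    have : 3 * a + 1 = 2 * (s + 1) + t + 1 := by omega
    exact_mod_cast this
  rw [hs, show 2 * a - b = s + 1 by omega, show 2 * b + 1 - a = t + 1 by omega, hq]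
  linear_combination (-1 : ℚ) ^ b * key

theorem prod_factorial_shift (n : ℕ) :
    (∏ i ∈ range n, ((n + i).factorial : ℚ)) * ∏ i ∈ range n, (i.factorial : ℚ) =
      (∏ i ∈ range n, ((2 * i).factorial : ℚ)) * ∏ i ∈ range n, ((2 * i + 1).factorial : ℚ) := by
  induction n with
  | zero => simp
  | succ n ih =>
    have h : (∏ i ∈ range (n + 1), ((n + 1 + i).factorial : ℚ)) * n.factorial =
        (∏ i ∈ range n, ((n + i).factorial : ℚ)) * (2 * n).factorial * (2 * n + 1).factorial := by
      rw [prod_range_succ, show n + 1 + n = 2 * n + 1 by ring]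
      have := prod_range_succ' (fun i => ((n + i).factorial : ℚ)) n
      rw [prod_range_succ, ← two_mul] at this
      have e : ∏ k ∈ range n, ((n + (k + 1)).factorial : ℚ) =
          ∏ k ∈ range n, ((n + 1 + k).factorial : ℚ) :=
        prod_congr rfl fun k _ => by rw [← add_assoc, add_right_comm]
      rw [e, add_zero] at this
      linear_combination -((2 * n + 1).factorial : ℚ) * this
    rw [prod_range_succ (fun i => (i.factorial : ℚ)),
      prod_range_succ (fun i => ((2 * i).factorial : ℚ)),
      prod_range_succ (fun i => ((2 * i + 1).factorial : ℚ))]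
    linear_combination (∏ i ∈ range n, (i.factorial : ℚ)) * h +
      (2 * n).factorial * (2 * n + 1).factorial * ih

theorem abs_det_evenOddGram (n : ℕ) :
    |(evenOddGram n).det| =
      (∏ i ∈ range n, (((3 * i + 1).factorial : ℚ) / ((n + i).factorial : ℚ))) ^ 2 := by
  have h1 : evenOddGram n = Matrix.of fun (a b : Fin n) => (-1) ^ (a : ℕ) *
      (Matrix.of fun (a b : Fin n) => (-1) ^ (b : ℕ) * (Matrix.of fun (a b : Fin n) =>
        (3 * ((a : ℕ) : ℚ) + 1) * binomialMatrix n 0 1 a b) a b) a b := by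
    ext a b
    exact evenOddGram_apply a b
  have h2 := det_binomialMatrix n 0 1 one_pos
  rw [h1, Matrix.det_mul_column, Matrix.det_mul_row, Matrix.det_mul_column,
    Fin.prod_univ_eq_prod_range (fun i => (3 * i + 1 : ℚ)) n]
  push_cast at h2
  rw [h2, abs_mul, abs_mul, abs_mul]
  have hfac : ∀ i : ℕ, (3 * (i : ℚ) + 1) * binomialRatio i 0 1 =
      ((3 * i + 1).factorial * i.factorial / ((2 * i).factorial * (2 * i + 1).factorial)) ^ 2 := by
    intro i
    have e1 := congrArg (Nat.cast (R := ℚ)) (Nat.factorial_mul_ascFactorial (2 * i) i)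
    have e2 := congrArg (Nat.cast (R := ℚ)) (Nat.factorial_mul_ascFactorial (2 * i + 1) i)
    rw [show 2 * i + i = 3 * i by ring] at e1
    rw [show 2 * i + 1 + i = 3 * i + 1 by ring] at e2
    rw [binomialRatio_eq (s := i) (a := 2 * i + 1) (b := 2 * i + 1 + 1) (u := 2 * i)
      (v := 2 * i + 1) (by ring) (by ring) (by ring) (by ring) (by ring)]
    have e3 : ((3 * i + 1).factorial : ℚ) = (3 * i + 1) * (3 * i).factorial := by
      rw [Nat.factorial_succ]; push_cast; ring
    have := (Nat.cast_ne_zero (R := ℚ)).2 (Nat.factorial_ne_zero (2 * i))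
    have := (Nat.cast_ne_zero (R := ℚ)).2 (Nat.factorial_ne_zero (2 * i + 1))
    push_cast at e1 e2
    rw [div_pow, mul_div_assoc', div_eq_div_iff (by positivity) (by positivity)]
    have : ((3 * i + 1).factorial : ℚ) ^ 2 = (3 * i + 1) * ((2 * i).factorial *
        ((2 * i + 1).ascFactorial i)) *
        ((2 * i + 1).factorial * ((2 * i + 1 + 1).ascFactorial i)) := by
      rw [e1, e2, ← e3]; ring
    rw [mul_pow ((3 * i + 1).factorial : ℚ), this]
    ring
  have hsign : |∏ i : Fin n, (-1 : ℚ) ^ (i : ℕ)| = 1 := by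
    rw [abs_prod]; simp
  rw [hsign, one_mul, one_mul, ← abs_mul, ← prod_mul_distrib, prod_congr rfl fun i _ => hfac i,
    prod_pow, abs_pow, sq_abs]
  congr 1
  have hs := prod_factorial_shift n
  simp only [prod_div_distrib, prod_mul_distrib]
  have f := fun g : ℕ → ℕ => (prod_ne_zero_iff (s := range n)
    (f := fun i => ((g i).factorial : ℚ))).2 fun i _ =>
      (Nat.cast_ne_zero (R := ℚ)).2 (Nat.factorial_ne_zero _)
  rw [div_eq_div_iff (mul_ne_zero (f _) (f _)) (f _)]
  linear_combination (∏ i ∈ range n, ((3 * i + 1).factorial : ℚ)) * hs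

/-- The number of chains of rows ending with a full row. -/
theorem card_rowChains_full (n : ℕ) :
    (#{c ∈ rowChains (2 * n) | c (2 * n) = List.replicate (2 * n) true} : ℚ) =
      (∏ i ∈ range n, (((3 * i + 1).factorial : ℚ) / ((n + i).factorial : ℚ))) ^ 2 := by
  rw [← abs_det_evenOddGram]
  have h := congrArg (detForm n) (sum_rowWedge_rowChains (R := ℚ)
    (fun h i => reflectionCoords n (rowPolynomial h i))
    (fun h i hi => by rw [← map_add, ← rowPolynomial_eq_add hi]) (2 * n))
  simp only [rowPolynomial, Nat.add_sub_cancel, Nat.sub_zero, Nat.sub_self, pow_zero, mul_one,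
    one_mul] at h
  rw [detForm_prod_one_add_reflectionCoords, map_sum,
    ← sum_filter_of_ne (p := fun c => c (2 * n) = List.replicate (2 * n) true)] at h
  · rw [sum_congr rfl fun c hc => by rw [(mem_filter.1 hc).2], sum_const, nsmul_eq_mul] at h
    have h' := congrArg abs h
    have hw := abs_detForm_rowWedge n
    simp only [rowPolynomial] at hw
    rw [abs_mul, abs_mul, hw, Nat.abs_cast, abs_pow, abs_two, mul_comm] at h'
    exact mul_left_cancel₀ (by positivity) h'
  · intro c hc hne
    by_contra hfull
    apply hne
    refine detForm_eq_zero ?_ (rowWedge_mem_exteriorPower _ _)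
    intro hcount
    have hlen := length_of_mem_rowChains hc
    refine hfull (List.eq_replicate_iff.2 ⟨hlen, fun b hb => ?_⟩)
    exact (List.count_eq_length.1 (hcount.trans hlen.symm) b hb).symm

end ReflectionBasis

/-- The conditions on the numbers `C h b` of points `(t + h, t + b, t)` in a cyclically symmetric
self-complementary plane partition in a cube of side `m`. -/
structure IsDiagonalArray (m : ℕ) (C : ℕ → ℕ → ℕ) : Prop where
  eq_zero : ∀ h b, h < b ∨ m ≤ h → C h b = 0
  succ_left_le : ∀ h b, b ≤ h → C (h + 1) b ≤ C h b
  succ_right_le : ∀ h b, C h (b + 1) ≤ C h b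
  le_succ : ∀ h b, b ≤ h → C h b ≤ C (h + 1) (b + 1) + 1
  add_add : ∀ h ≤ m, C h 0 + C h h + h = m

/-- The bits of the steps of a weakly decreasing sequence: `true` where it is constant. -/
def stepBits : ℕ → (ℕ → ℕ) → List Bool
  | 0, _ => []
  | h + 1, x => decide (x 0 = x 1) :: stepBits h fun i => x (i + 1)

theorem stepBits_zero_right (h : ℕ) : stepBits h (fun _ => 0) = List.replicate h true := by
  induction h with
  | zero => rfl
  | succ h ih => simp [stepBits, ih, List.replicate_succ]

theorem stepBits_congr_iff {h : ℕ} {x y : ℕ → ℕ} (e : stepBits h x = stepBits h y) :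
    ∀ i < h, (x i = x (i + 1) ↔ y i = y (i + 1)) := by
  induction h generalizing x y with
  | zero => simp
  | succ h ih =>
    simp only [stepBits, List.cons.injEq, decide_eq_decide] at e
    intro i hi
    cases i with
    | zero => exact e.1
    | succ i => exact ih e.2 i (by omega)

theorem stepBits_mem_interlacing {δ D : Bool} {h : ℕ} {x x' : ℕ → ℕ}
    (h0 : x 0 = x' 0 + D.toNat) (hx : ∀ b < h, x (b + 1) ≤ x b)
    (hx' : ∀ b ≤ h, x' (b + 1) ≤ x' b)
    (hle : ∀ b ≤ h, x' b ≤ x b) (hle' : ∀ b ≤ h, x b ≤ x' (b + 1) + 1)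
    (hl : x h + δ.toNat = x' (h + 1) + 1) :
    stepBits (h + 1) x' ∈ interlacing δ D (stepBits h x) := by
  induction h generalizing D x x' with
  | zero =>
    have := hle 0 le_rfl
    have := hle' 0 le_rfl
    have := hx' 0 le_rfl
    cases D <;> cases δ <;> simp [interlacing, stepBits] at * <;> omega
  | succ h ih =>
    have a1 := hle 0 (by omega)
    have a2 := hle' 0 (by omega)
    have a3 := hx' 0 (by omega)
    have a4 := hx 0 (by omega)
    have a5 := hle 1 (by omega)
    have a6 := hle' 1 (by omega)
    have a7 := hx' 1 (by omega)
    have key : ∀ D' : Bool, x 1 = x' 1 + D'.toNat →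
        stepBits (h + 1) (fun i => x' (i + 1)) ∈
          interlacing δ D' (stepBits h fun i => x (i + 1)) := fun D' hD' =>
      ih hD' (fun b hb => hx _ (by omega)) (fun b hb => hx' _ (by omega))
        (fun b hb => hle _ (by omega)) (fun b hb => hle' _ (by omega)) hl
    have kt := key true
    have kf := key false
    rw [stepBits, stepBits]
    simp only [zero_add] at a2 a3 a4
    by_cases hu : x 0 = x 1 <;> by_cases hv : x' 0 = x' 1 <;> cases D <;>
      simp only [Bool.toNat_true, Bool.toNat_false] at h0 kt kf <;>
      simp only [hu, hv, decide_true, decide_false, interlacing, List.mem_map, List.mem_append,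
        List.cons.injEq, true_and, false_and, and_false, exists_false, exists_eq_right, or_false,
        false_or, reduceCtorEq] <;>
      first
        | exact kt (by omega)
        | exact kf (by omega)
        | omega

theorem exists_of_stepBits_mem_interlacing {δ D : Bool} {us : List Bool} {x' : ℕ → ℕ}
    (hx' : ∀ b ≤ us.length, x' (b + 1) ≤ x' b ∧ x' b ≤ x' (b + 1) + 1)
    (hmem : stepBits (us.length + 1) x' ∈ interlacing δ D us) :
    ∃ x : ℕ → ℕ, stepBits us.length x = us ∧ x 0 = x' 0 + D.toNat ∧
      (∀ b < us.length, x (b + 1) ≤ x b) ∧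
      (∀ b ≤ us.length, x' b ≤ x b ∧ x b ≤ x' (b + 1) + 1) ∧
      (∀ b, us.length < b → x b = 0) ∧
      x us.length + δ.toNat = x' (us.length + 1) + 1 := by
  induction us generalizing D x' with
  | nil =>
    have := hx' 0 le_rfl
    refine ⟨fun b => if b = 0 then x' 0 + D.toNat else 0, ?_⟩
    cases D <;> cases δ <;> simp [interlacing, stepBits] at * <;> grind
  | cons u us ih =>
    have a0 := hx' 0 (by simp)
    have key : ∀ D' : Bool, stepBits (us.length + 1) (fun i => x' (i + 1)) ∈
        interlacing δ D' us → ∃ x : ℕ → ℕ, stepBits us.length x = us ∧ x 0 = x' 1 + D'.toNat ∧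
      (∀ b < us.length, x (b + 1) ≤ x b) ∧
      (∀ b ≤ us.length, x' (b + 1) ≤ x b ∧ x b ≤ x' (b + 1 + 1) + 1) ∧
      (∀ b, us.length < b → x b = 0) ∧
      x us.length + δ.toNat = x' (us.length + 1 + 1) + 1 := fun D' hD' =>
      ih (fun b hb => hx' (b + 1) (by simpa using hb)) hD'
    obtain ⟨D', hD', hDD⟩ : ∃ D' : Bool, stepBits (us.length + 1) (fun i => x' (i + 1)) ∈
        interlacing δ D' us ∧ x' 0 + D.toNat = x' 1 + D'.toNat + (!u).toNat ∧
          (D = true → x' 0 = x' 1) := by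
      rw [List.length_cons, stepBits] at hmem
      by_cases hv : x' 0 = x' 1 <;> cases D <;> cases u <;>
        simp [interlacing, hv] at hmem <;>
        first
          | exact ⟨true, hmem, by simp at *; omega⟩
          | exact ⟨false, hmem, by simp at *; omega⟩
    obtain ⟨x, e, h0, hx, hle, hz, hl⟩ := key D' hD'
    refine ⟨fun b => b.casesOn (x' 0 + D.toNat) x, ?_, rfl, ?_, ?_, ?_, hl⟩
    · simp only [List.length_cons, stepBits, e, List.cons.injEq, and_true]
      cases u <;> simp at hDD ⊢ <;> omega
    · rintro (_ | b) hb
      · change x 0 ≤ x' 0 + D.toNat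
        omega
      · exact hx b (by simpa using hb)
    · rintro (_ | b) hb
      · change x' 0 ≤ x' 0 + D.toNat ∧ x' 0 + D.toNat ≤ x' 1 + 1
        have := a0.2
        cases D <;> simp at hDD ⊢ <;> omega
      · exact hle b (by simpa using hb)
    · rintro (_ | b) hb
      · simp at hb
      · exact hz b (by simpa using hb)

theorem IsDiagonalArray.le_succ_right {m : ℕ} {C : ℕ → ℕ → ℕ} (hC : IsDiagonalArray m C)
    {h b : ℕ} (hb : b < h) : C h b ≤ C h (b + 1) + 1 :=
  (hC.le_succ h b hb.le).trans (Nat.succ_le_succ (hC.succ_left_le h (b + 1) hb))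

/-- The chain of rows of a diagonal array. -/
def arrayRows (m : ℕ) (C : ℕ → ℕ → ℕ) (h : ℕ) : List Bool :=
  if h ≤ m then stepBits h (C h) else []

theorem IsDiagonalArray.arrayRows_mem {m : ℕ} {C : ℕ → ℕ → ℕ} (hC : IsDiagonalArray m C) :
    arrayRows m C ∈ rowChains m := by
  refine mem_rowChains.2 ⟨by simp [arrayRows, stepBits], fun h hh => ?_, fun h hh => ?_⟩
  · rw [arrayRows, arrayRows, if_pos hh.le, if_pos (show h + 1 ≤ m from hh), nextRows,
      List.mem_append]
    have e1 := hC.add_add h hh.le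
    have e2 := hC.add_add (h + 1) hh
    have l1 := hC.succ_left_le h 0 h.zero_le
    have l2 := (hC.le_succ h 0 (by omega)).trans (Nat.succ_le_succ (hC.succ_right_le (h + 1) 0))
    have key : ∀ D : Bool, C h 0 = C (h + 1) 0 + D.toNat →
        stepBits (h + 1) (C (h + 1)) ∈ interlacing D D (stepBits h (C h)) := fun D hD =>
      stepBits_mem_interlacing hD (fun b _ => hC.succ_right_le h b)
        (fun b _ => hC.succ_right_le (h + 1) b) (hC.succ_left_le h)
        (hC.le_succ h) (by omega)
    rcases Nat.lt_or_ge (C (h + 1) 0) (C h 0) with hlt | hge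
    · exact Or.inr (key true (by simp; omega))
    · exact Or.inl (key false (by simp; omega))
  · rw [arrayRows, if_neg (by omega)]

theorem IsDiagonalArray.arrayRows_self {m : ℕ} {C : ℕ → ℕ → ℕ} (hC : IsDiagonalArray m C) :
    arrayRows m C m = List.replicate m true := by
  rw [arrayRows, if_pos le_rfl, ← stepBits_zero_right]
  congr 1
  funext b
  exact hC.eq_zero m b (Or.inr le_rfl)

theorem IsDiagonalArray.eq_of_arrayRows_eq {m : ℕ} {C C' : ℕ → ℕ → ℕ} (hC : IsDiagonalArray m C)
    (hC' : IsDiagonalArray m C') (e : arrayRows m C = arrayRows m C') : C = C' := by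
  funext h b
  by_cases hz : h < b ∨ m ≤ h
  · rw [hC.eq_zero h b hz, hC'.eq_zero h b hz]
  have hh : h ≤ m := by omega
  have eh := congrFun e h
  rw [arrayRows, arrayRows, if_pos hh, if_pos hh] at eh
  have hbits := stepBits_congr_iff eh
  have key : ∀ b ≤ h, C h b + C' h 0 = C' h b + C h 0 := by
    intro b
    induction b with
    | zero => intro _; omega
    | succ b ih =>
      intro hb
      have := ih (by omega)
      have := hbits b hb
      have := hC.succ_right_le h b
      have := hC'.succ_right_le h b
      have := hC.le_succ_right (h := h) (b := b) hb
      have := hC'.le_succ_right (h := h) (b := b) hb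
      omega
  have := key h le_rfl
  have := key b (by omega)
  have := hC.add_add h hh
  have := hC'.add_add h hh
  omega

theorem exists_isDiagonalArray {m : ℕ} {c : ℕ → List Bool} (hc : c ∈ rowChains m)
    (hfull : c m = List.replicate m true) :
    ∃ C, IsDiagonalArray m C ∧ arrayRows m C = c := by
  obtain ⟨-, hstep, hz⟩ := mem_rowChains.1 hc
  have hlen := length_of_mem_rowChains_of_le hc
  have key : ∀ d ≤ m, ∃ C : ℕ → ℕ → ℕ, (∀ h b, h < b ∨ m ≤ h → C h b = 0) ∧
      ∀ h ≤ m, m ≤ h + d → stepBits h (C h) = c h ∧ C h 0 + C h h + h = m ∧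
        (∀ b < h, C h (b + 1) ≤ C h b) ∧
        (h < m → ∀ b ≤ h, C (h + 1) b ≤ C h b ∧ C h b ≤ C (h + 1) (b + 1) + 1) := by
    intro d
    induction d with
    | zero =>
      intro _
      refine ⟨fun _ _ => 0, fun _ _ _ => rfl, fun h hh hd => ?_⟩
      obtain rfl : h = m := by omega
      refine ⟨by rw [stepBits_zero_right, hfull], by simp, by simp, by simp⟩
    | succ d ih =>
      intro hd
      obtain ⟨C, hC0, hC⟩ := ih (by omega)
      obtain ⟨k, hk⟩ : ∃ k, m = k + (d + 1) := ⟨m - (d + 1), by omega⟩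
      obtain ⟨e, hs, hmono, hn⟩ := hC (k + 1) (by omega) (by omega)
      have hl := hlen k (by omega)
      have hx' : ∀ b ≤ (c k).length, C (k + 1) (b + 1) ≤ C (k + 1) b ∧
          C (k + 1) b ≤ C (k + 1) (b + 1) + 1 := by
        intro b hb
        refine ⟨hmono b (by omega), ?_⟩
        rcases Nat.lt_or_ge (k + 1) m with hlt | hge
        · have h1 := (hn hlt b (by omega)).2
          have h2 := (hn hlt (b + 1) (by omega)).1
          omega
        · rw [hC0 _ _ (Or.inr hge)]; omega
      obtain ⟨D, hD⟩ : ∃ D, c (k + 1) ∈ interlacing D D (c k) := by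
        have := hstep k (by omega)
        rw [nextRows, List.mem_append] at this
        exact this.elim (fun h => ⟨_, h⟩) fun h => ⟨_, h⟩
      rw [← e, ← hl] at hD
      rw [hl] at hD
      obtain ⟨x, hxe, hx0, hxm, hxi, hxz, hxl⟩ :=
        exists_of_stepBits_mem_interlacing hx' (by rw [hl]; exact hD)
      rw [hl] at hxe hxm hxi hxz hxl
      refine ⟨Function.update C k x, fun h b hb => ?_, fun h hh hd => ?_⟩
      · rcases eq_or_ne h k with rfl | hne
        · rw [Function.update_self]
          exact hxz b (by omega)
        · rw [Function.update_of_ne hne]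
          exact hC0 h b hb
      · rw [Function.update_of_ne (show h + 1 ≠ k by omega)]
        rcases eq_or_ne h k with rfl | hne
        · rw [Function.update_self]
          exact ⟨hxe, by omega, hxm, fun _ => hxi⟩
        · rw [Function.update_of_ne hne]
          exact hC h hh (by omega)
  obtain ⟨C, hC0, hC⟩ := key m le_rfl
  have hC := fun h hh => hC h hh (by omega)
  refine ⟨C, ⟨hC0, fun h b hb => ?_, fun h b => ?_, fun h b hb => ?_, fun h hh => (hC h hh).2.1⟩,
    ?_⟩
  · rcases Nat.lt_or_ge h m with hh | hh
    · exact ((hC h hh.le).2.2.2 hh b hb).1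
    · rw [hC0 (h + 1) b (by omega)]; omega
  · rcases Nat.lt_or_ge b h with hb | hb
    · rcases Nat.lt_or_ge h m with hh | hh
      · exact (hC h hh.le).2.2.1 b hb
      · rw [hC0 h _ (by omega)]; omega
    · rw [hC0 h _ (by omega)]; omega
  · rcases Nat.lt_or_ge h m with hh | hh
    · exact ((hC h hh.le).2.2.2 hh b hb).2
    · rw [hC0 h b (by omega)]; omega
  · funext h
    rw [arrayRows]
    split_ifs with hh
    · exact (hC h hh).1
    · exact (hz h (by omega)).symm

theorem card_isDiagonalArray (m : ℕ) :
    Nat.card {C // IsDiagonalArray m C} =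
      #{c ∈ rowChains m | c m = List.replicate m true} := by
  rw [← Nat.card_eq_finsetCard]
  refine Nat.card_congr (Equiv.ofBijective
    (fun C => ⟨arrayRows m C.1, mem_filter.2 ⟨C.2.arrayRows_mem, C.2.arrayRows_self⟩⟩) ⟨?_, ?_⟩)
  · intro C C' e
    exact Subtype.ext (C.2.eq_of_arrayRows_eq C'.2 (congrArg Subtype.val e))
  · rintro ⟨c, hc⟩
    obtain ⟨C, hC, e⟩ := exists_isDiagonalArray (mem_filter.1 hc).1 (mem_filter.1 hc).2
    exact ⟨⟨C, hC⟩, Subtype.ext e⟩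

/-- Cyclically symmetric self-complementary plane partitions in the cube of side `m`. -/
def IsCSSC (m : ℕ) (S : Set (Fin m × Fin m × Fin m)) : Prop :=
  IsLowerSet S ∧ (∀ i j k, (i, j, k) ∈ S ↔ (j, k, i) ∈ S) ∧
    ∀ i j k, (i, j, k) ∈ S ↔ (i.rev, j.rev, k.rev) ∉ S

/-- Membership of `(i, j, k)`, when the coordinates are monotone, in the plane partition of a
diagonal array. -/
def SortedMem (m : ℕ) (C : ℕ → ℕ → ℕ) (i j k : ℕ) : Prop :=
  (k ≤ j ∧ j ≤ i ∧ k < C (i - k) (j - k)) ∨ (i ≤ j ∧ j ≤ k ∧ k + C (k - i) (k - j) < m)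

/-- Membership of `(i, j, k)` in the plane partition of a diagonal array. -/
def CyclicMem (m : ℕ) (C : ℕ → ℕ → ℕ) (i j k : ℕ) : Prop :=
  SortedMem m C i j k ∨ SortedMem m C j k i ∨ SortedMem m C k i j

theorem cyclicMem_rotate {m : ℕ} {C : ℕ → ℕ → ℕ} {i j k : ℕ} :
    CyclicMem m C i j k ↔ CyclicMem m C j k i := by
  unfold CyclicMem; tauto

theorem IsDiagonalArray.cyclicMem_of_antitone {m : ℕ} {C : ℕ → ℕ → ℕ} (hC : IsDiagonalArray m C)
    {i j k : ℕ} (hkj : k ≤ j) (hji : j ≤ i) (hi : i < m) :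
    CyclicMem m C i j k ↔ k < C (i - k) (j - k) := by
  have hs := hC.add_add (i - k) (by omega)
  unfold CyclicMem SortedMem
  rcases hkj.eq_or_lt with rfl | hkj <;> rcases hji.eq_or_lt with rfl | hji <;>
    (try simp only [Nat.sub_self] at *) <;> omega

theorem IsDiagonalArray.cyclicMem_of_monotone {m : ℕ} {C : ℕ → ℕ → ℕ} (hC : IsDiagonalArray m C)
    {i j k : ℕ} (hij : i ≤ j) (hjk : j ≤ k) (hk : k < m) :
    CyclicMem m C i j k ↔ k + C (k - i) (k - j) < m := by
  have hs := hC.add_add (k - i) (by omega)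
  unfold CyclicMem SortedMem
  rcases hij.eq_or_lt with rfl | hij <;> rcases hjk.eq_or_lt with rfl | hjk <;>
    (try simp only [Nat.sub_self] at *) <;> omega

theorem exists_rotate_monotone {P : ℕ → ℕ → ℕ → Prop} (hP : ∀ i j k, P j k i → P i j k)
    (anti : ∀ i j k, k ≤ j → j ≤ i → P i j k) (mono : ∀ i j k, i ≤ j → j ≤ k → P i j k)
    (i j k : ℕ) : P i j k := by
  have key : ∀ i j k, k ≤ i → k ≤ j → P i j k := by
    intro i j k hi hj
    rcases Nat.le_total j i with h | h
    · exact anti i j k hj h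
    · exact hP _ _ _ (hP _ _ _ (mono k i j hi h))
  rcases Nat.le_total i j with h1 | h1 <;> rcases Nat.le_total j k with h2 | h2 <;>
    rcases Nat.le_total i k with h3 | h3 <;>
    first
      | exact key i j k (by omega) (by omega)
      | exact hP _ _ _ (key j k i (by omega) (by omega))
      | exact hP _ _ _ (hP _ _ _ (key k i j (by omega) (by omega)))

theorem IsDiagonalArray.cyclicMem_compl {m : ℕ} {C : ℕ → ℕ → ℕ} (hC : IsDiagonalArray m C) :
    ∀ i j k, i < m → j < m → k < m →
      (CyclicMem m C i j k ↔ ¬ CyclicMem m C (m - 1 - i) (m - 1 - j) (m - 1 - k)) := by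
  apply exists_rotate_monotone
  · intro i j k h hi hj hk
    rw [cyclicMem_rotate, h hj hk hi, ← cyclicMem_rotate]
  · intro i j k hkj hji hi hj hk
    rw [hC.cyclicMem_of_antitone hkj hji hi,
      hC.cyclicMem_of_monotone (by omega) (by omega) (by omega),
      show m - 1 - k - (m - 1 - i) = i - k by omega, show m - 1 - k - (m - 1 - j) = j - k by omega]
    omega
  · intro i j k hij hjk hi hj hk
    rw [hC.cyclicMem_of_monotone hij hjk hk,
      hC.cyclicMem_of_antitone (by omega) (by omega) (by omega),
      show m - 1 - i - (m - 1 - k) = k - i by omega, show m - 1 - j - (m - 1 - k) = k - j by omega]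
    omega

theorem IsDiagonalArray.cyclicMem_of_succ {m : ℕ} {C : ℕ → ℕ → ℕ} (hC : IsDiagonalArray m C)
    {i j k : ℕ} (hi : i + 1 < m) (hj : j < m) (hk : k < m) (h : CyclicMem m C (i + 1) j k) :
    CyclicMem m C i j k := by
  rcases Nat.lt_or_ge i j with h1 | h1 <;> rcases Nat.lt_or_ge i k with h2 | h2
  · rcases Nat.le_total k j with h3 | h3
    · rw [cyclicMem_rotate, hC.cyclicMem_of_antitone (by omega) (by omega) (by omega)] at h ⊢
      have := hC.le_succ (j - (i + 1)) (k - (i + 1)) (by omega)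
      rw [show j - (i + 1) + 1 = j - i by omega, show k - (i + 1) + 1 = k - i by omega] at this
      omega
    · rw [hC.cyclicMem_of_monotone (by omega) (by omega) (by omega)] at h ⊢
      have := hC.succ_left_le (k - (i + 1)) (k - j) (by omega)
      rw [show k - (i + 1) + 1 = k - i by omega] at this
      omega
  · rw [← cyclicMem_rotate, hC.cyclicMem_of_monotone (by omega) (by omega) (by omega)] at h ⊢
    have := hC.succ_right_le (j - k) (j - (i + 1))
    rw [show j - (i + 1) + 1 = j - i by omega] at this
    omega
  · rw [← cyclicMem_rotate, hC.cyclicMem_of_antitone (by omega) (by omega) (by omega)] at h ⊢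
    have := hC.succ_right_le (k - j) (i - j)
    rw [show i - j + 1 = i + 1 - j by omega] at this
    omega
  · rcases Nat.le_total k j with h3 | h3
    · rw [hC.cyclicMem_of_antitone (by omega) (by omega) (by omega)] at h ⊢
      have := hC.succ_left_le (i - k) (j - k) (by omega)
      rw [show i - k + 1 = i + 1 - k by omega] at this
      omega
    · rw [cyclicMem_rotate, hC.cyclicMem_of_monotone (by omega) (by omega) (by omega)] at h ⊢
      have := hC.le_succ (i - j) (i - k) (by omega)
      rw [show i - j + 1 = i + 1 - j by omega, show i - k + 1 = i + 1 - k by omega] at this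
      omega

theorem IsDiagonalArray.cyclicMem_of_le {m : ℕ} {C : ℕ → ℕ → ℕ} (hC : IsDiagonalArray m C)
    {i i' j k : ℕ} (hi : i' ≤ i) (him : i < m) (hj : j < m) (hk : k < m)
    (h : CyclicMem m C i j k) : CyclicMem m C i' j k := by
  induction i, hi using Nat.le_induction with
  | base => exact h
  | succ i hi ih => exact ih (by omega) (hC.cyclicMem_of_succ him hj hk h)

/-- The plane partition of a diagonal array. -/
def arraySet (m : ℕ) (C : ℕ → ℕ → ℕ) : Set (Fin m × Fin m × Fin m) :=
  {p | CyclicMem m C p.1 p.2.1 p.2.2}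

theorem IsDiagonalArray.isCSSC_arraySet {m : ℕ} {C : ℕ → ℕ → ℕ} (hC : IsDiagonalArray m C) :
    IsCSSC m (arraySet m C) := by
  refine ⟨?_, fun i j k => cyclicMem_rotate, fun i j k => ?_⟩
  · rintro ⟨i, j, k⟩ ⟨i', j', k'⟩ ⟨hi, hj, hk⟩ h
    have h1 : CyclicMem m C i' j k := hC.cyclicMem_of_le hi i.2 j.2 k.2 h
    have h2 : CyclicMem m C j' k i' :=
      hC.cyclicMem_of_le hj j.2 k.2 i'.2 (cyclicMem_rotate.1 h1)
    have h3 : CyclicMem m C k' i' j' :=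
      hC.cyclicMem_of_le hk k.2 i'.2 j'.2 (cyclicMem_rotate.1 h2)
    exact cyclicMem_rotate.1 h3
  · have := hC.cyclicMem_compl i j k i.2 j.2 k.2
    simp only [arraySet, Set.mem_ofPred_eq, Fin.val_rev]
    rw [this, Nat.sub_sub, Nat.sub_sub, Nat.sub_sub, add_comm 1, add_comm 1, add_comm 1]

theorem IsDiagonalArray.mem_arraySet_iff {m : ℕ} {C : ℕ → ℕ → ℕ} (hC : IsDiagonalArray m C)
    {h b t : ℕ} (hb : b ≤ h) (ht : t + h < m) :
    ((⟨t + h, ht⟩, ⟨t + b, by omega⟩, ⟨t, by omega⟩) : Fin m × Fin m × Fin m) ∈ arraySet m C ↔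
      t < C h b := by
  have := hC.cyclicMem_of_antitone (show t ≤ t + b by omega) (show t + b ≤ t + h by omega) ht
  rwa [Nat.add_sub_cancel_left, Nat.add_sub_cancel_left] at this

theorem IsDiagonalArray.le_sub {m : ℕ} {C : ℕ → ℕ → ℕ} (hC : IsDiagonalArray m C) (h b : ℕ) :
    C h b ≤ m - h := by
  rcases Nat.lt_or_ge h m with hh | hh
  · have : C h b ≤ C h 0 := antitone_nat_of_succ_le (hC.succ_right_le h) (Nat.zero_le b)
    have := hC.add_add h hh.le
    omega
  · rw [hC.eq_zero h b (Or.inr hh)]; omega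

theorem IsDiagonalArray.eq_of_arraySet_eq {m : ℕ} {C C' : ℕ → ℕ → ℕ} (hC : IsDiagonalArray m C)
    (hC' : IsDiagonalArray m C') (e : arraySet m C = arraySet m C') : C = C' := by
  funext h b
  rcases Nat.lt_or_ge h b with hb | hb
  · rw [hC.eq_zero h b (Or.inl hb), hC'.eq_zero h b (Or.inl hb)]
  have l := hC.le_sub h b
  have l' := hC'.le_sub h b
  have key : ∀ t, t + h < m → (t < C h b ↔ t < C' h b) := fun t ht => by
    rw [← hC.mem_arraySet_iff hb ht, ← hC'.mem_arraySet_iff hb ht, e]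
  have k1 := key (C h b)
  have k2 := key (C' h b)
  omega

theorem exists_arraySet_eq {m : ℕ} {S : Set (Fin m × Fin m × Fin m)} (hS : IsCSSC m S) :
    ∃ C, IsDiagonalArray m C ∧ arraySet m C = S := by
  classical
  obtain ⟨hlow, hcyc, hcomp⟩ := hS
  set P : ℕ → ℕ → ℕ → Prop := fun i j k =>
    ∃ (hi : i < m) (hj : j < m) (hk : k < m), ((⟨i, hi⟩, ⟨j, hj⟩, ⟨k, hk⟩) : Fin m × _ × _) ∈ S
    with hP
  have plow : ∀ {i j k i' j' k'}, P i j k → i' ≤ i → j' ≤ j → k' ≤ k → P i' j' k' := by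
    rintro i j k i' j' k' ⟨hi, hj, hk, h⟩ hi' hj' hk'
    exact ⟨by omega, by omega, by omega, hlow ⟨hi', hj', hk'⟩ h⟩
  have pcyc : ∀ {i j k}, P i j k ↔ P j k i := by
    intro i j k
    constructor
    · rintro ⟨hi, hj, hk, h⟩
      exact ⟨hj, hk, hi, (hcyc _ _ _).1 h⟩
    · rintro ⟨hj, hk, hi, h⟩
      exact ⟨hi, hj, hk, (hcyc _ _ _).2 h⟩
  have pcomp : ∀ {i j k}, i < m → j < m → k < m →
      (P i j k ↔ ¬ P (m - 1 - i) (m - 1 - j) (m - 1 - k)) := by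
    intro i j k hi hj hk
    have h := hcomp ⟨i, hi⟩ ⟨j, hj⟩ ⟨k, hk⟩
    simp only [Fin.rev, Nat.sub_add_eq, Nat.sub_right_comm m _ 1] at h
    simp only [hP]
    constructor
    · rintro ⟨_, _, _, h'⟩ ⟨_, _, _, h''⟩
      exact h.1 h' h''
    · intro h'
      exact ⟨hi, hj, hk, h.2 fun h'' => h' ⟨_, _, _, h''⟩⟩
  have hex : ∀ h b, ∃ t, ¬ P (t + h) (t + b) t := fun h b => ⟨m, fun hp => by
    obtain ⟨hi, -⟩ := hp; omega⟩
  set C : ℕ → ℕ → ℕ := fun h b => if b ≤ h then Nat.find (hex h b) else 0 with hCdef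
  have hlt : ∀ {h b t}, b ≤ h → (t < C h b ↔ P (t + h) (t + b) t) := by
    intro h b t hb
    simp only [hCdef, if_pos hb, Nat.lt_find_iff, not_not]
    exact ⟨fun hp => hp t le_rfl, fun hp s hs => plow hp (by omega) (by omega) hs⟩
  have le_of : ∀ {a b : ℕ}, (∀ t < a, t < b) → a ≤ b := fun {a b} h => by
    by_contra hab
    exact lt_irrefl b (h b (by omega))
  have hC : IsDiagonalArray m C := by
    refine ⟨fun h b hhb => ?_, fun h b hb => le_of fun t ht => ?_, fun h b => le_of fun t ht => ?_,
      fun h b hb => le_of fun t ht => ?_, fun h hh => ?_⟩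
    · by_cases hb : b ≤ h
      · by_contra hne
        obtain ⟨hi, -⟩ := (hlt hb).1 (Nat.pos_of_ne_zero hne)
        omega
      · simp only [hCdef, if_neg hb]
    · exact (hlt hb).2 (plow ((hlt (by omega)).1 ht) (by omega) (by omega) le_rfl)
    · by_cases hb : b + 1 ≤ h
      · exact (hlt (by omega)).2 (plow ((hlt hb).1 ht) (by omega) (by omega) le_rfl)
      · simp only [hCdef, if_neg hb] at ht
        omega
    · rcases t with _ | t
      · omega
      · have := (hlt (by omega)).2 (plow ((hlt hb).1 ht) (show t + (h + 1) ≤ _ by omega)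
          (show t + (b + 1) ≤ _ by omega) (show t ≤ _ by omega))
        omega
    · have key : ∀ t, t + h < m → (t < C h 0 ↔ ¬ m - 1 - (t + h) < C h h) := by
        intro t ht
        rw [hlt h.zero_le, hlt le_rfl, pcomp (by omega) (by omega) (by omega), add_zero,
          show m - 1 - (t + h) + h = m - 1 - t by omega, ← pcyc, ← pcyc]
      have b0 : C h 0 + h ≤ m := by
        rcases Nat.eq_zero_or_pos (C h 0) with h0 | h0
        · omega
        · obtain ⟨hi, -⟩ := (hlt h.zero_le).1 (show C h 0 - 1 < C h 0 by omega)
          omega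
      have b1 : C h h + h ≤ m := by
        rcases Nat.eq_zero_or_pos (C h h) with h0 | h0
        · omega
        · obtain ⟨hi, -⟩ := (hlt le_rfl).1 (show C h h - 1 < C h h by omega)
          omega
      have k1 := key (C h 0)
      have k2 := key (C h 0 - 1)
      omega
  refine ⟨C, hC, ?_⟩
  have main : ∀ i j k, i < m → j < m → k < m → (CyclicMem m C i j k ↔ P i j k) := by
    have anti : ∀ i j k, k ≤ j → j ≤ i → i < m → j < m → k < m →
        (CyclicMem m C i j k ↔ P i j k) := by
      intro i j k hkj hji hi hj hk
      rw [hC.cyclicMem_of_antitone hkj hji hi, hlt (by omega), Nat.add_sub_cancel' hkj,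
        Nat.add_sub_cancel' (hkj.trans hji)]
    apply exists_rotate_monotone
    · intro i j k h hi hj hk
      rw [cyclicMem_rotate, h hj hk hi, ← pcyc]
    · exact anti
    · intro i j k hij hjk hi hj hk
      rw [hC.cyclicMem_compl i j k hi hj hk, pcomp hi hj hk,
        anti _ _ _ (by omega) (by omega) (by omega) (by omega) (by omega)]
  ext ⟨i, j, k⟩
  exact (main i j k i.2 j.2 k.2).trans ⟨fun ⟨_, _, _, h⟩ => h, fun h => ⟨i.2, j.2, k.2, h⟩⟩

theorem card_isCSSC (m : ℕ) : Nat.card {S // IsCSSC m S} = Nat.card {C // IsDiagonalArray m C} :=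
  .symm <| Nat.card_congr <| Equiv.ofBijective
    (fun C => ⟨arraySet m C.1, C.2.isCSSC_arraySet⟩)
    ⟨fun C C' e => Subtype.ext (C.2.eq_of_arraySet_eq C'.2 (congrArg Subtype.val e)),
      fun S => let ⟨C, hC, e⟩ := exists_arraySet_eq S.2; ⟨⟨C, hC⟩, Subtype.ext e⟩⟩

theorem CSSC_count (n : ℕ) (hn : 0 < n) :
    (Nat.card {S : Set (Fin (2 * n) × Fin (2 * n) × Fin (2 * n)) //
        IsLowerSet S ∧
        (∀ i j k, (i, j, k) ∈ S ↔ (j, k, i) ∈ S) ∧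
        (∀ i j k, (i, j, k) ∈ S ↔ (i.rev, j.rev, k.rev) ∉ S)} : ℚ) =
      (∏ i ∈ Finset.range n,
        (((3 * i + 1).factorial : ℚ) / ((n + i).factorial : ℚ))) ^ 2 := by
  rw [← card_rowChains_full, ← card_isDiagonalArray, ← card_isCSSC]
  rfl
end

section
/- Let x and y be positive integers. The number of plane partitions S contained in the 2x×2x×2y box that are self-complementary, i.e., (i,j,k) ∈ S if and only if (2x-1-i, 2x-1-j, 2y-1-k) ∉ S, equals PP(x,x,y)². -/
open Finset

/-- MacMahon's box formula `PP(a,b,c) = ∏_{i=1}^{a} ∏_{j=1}^{b} ∏_{k=1}^{c} (i+j+k-1)/(i+j+k-2)`. -/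
def PP (a b c : ℕ) : ℚ :=
  ∏ i ∈ Finset.Icc 1 a, ∏ j ∈ Finset.Icc 1 b, ∏ k ∈ Finset.Icc 1 c,
    (((i : ℚ) + j + k - 1) / ((i : ℚ) + j + k - 2))

/-- The number of Gelfand–Tsetlin patterns, in strict form, whose top row is `v`. -/
def gtCount : (n : ℕ) → (Fin n → ℕ) → ℕ
  | 0, _ => 1
  | n + 1, v => ∑ u ∈ Fintype.piFinset fun i : Fin n => Ico (v i.castSucc) (v i.succ), gtCount n u

theorem sum_Ico_choose_cast {a b : ℕ} (h : a ≤ b) (j : ℕ) :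
    ∑ u ∈ Ico a b, (u.choose j : ℚ) = b.choose (j + 1) - a.choose (j + 1) := by
  induction b, h using Nat.le_induction with
  | base => simp
  | succ b hb ih =>
    rw [sum_Ico_succ_top hb, ih, Nat.choose_succ_succ]
    push_cast
    ring

theorem det_choose_succ {n : ℕ} (v : Fin (n + 1) → ℕ) (hv : Monotone v) :
    (Matrix.of fun i j : Fin (n + 1) => ((v i).choose j : ℚ)).det =
      ∑ u ∈ Fintype.piFinset fun i : Fin n => Ico (v i.castSucc) (v i.succ),
        (Matrix.of fun i j : Fin n => ((u i).choose j : ℚ)).det := by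
  rw [Matrix.det_eq_of_forall_row_eq_smul_add_pred
    (B := Matrix.of fun i j : Fin (n + 1) => Fin.cases ((v 0).choose j : ℚ)
      (fun k : Fin n => ((v k.succ).choose j : ℚ) - (v k.castSucc).choose j) i)
    (fun _ => (1 : ℚ)) (by simp) (by simp), Matrix.det_succ_column_zero, Fin.sum_univ_succ]
  simp only [Matrix.of_apply, Fin.cases_succ, Fin.val_zero, Nat.choose_zero_right, sub_self,
    mul_zero, zero_mul, sum_const_zero, add_zero, Fin.cases_zero, pow_zero, Nat.cast_one, one_mul]
  have h := (Matrix.detRowAlternating (R := ℚ) (n := Fin n)).toMultilinearMap.map_sum_finset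
    (fun (_ : Fin n) (u : ℕ) => fun j : Fin n => (u.choose j : ℚ))
    (fun i : Fin n => Ico (v i.castSucc) (v i.succ))
  refine Eq.trans ?_ h
  change _ = Matrix.det _
  congr 1
  ext i j
  simp [sum_Ico_choose_cast (hv (Fin.castSucc_lt_succ (i := i)).le)]

theorem gtCount_eq_det {n : ℕ} (v : Fin n → ℕ) (hv : Monotone v) :
    (gtCount n v : ℚ) = (Matrix.of fun i j : Fin n => ((v i).choose j : ℚ)).det := by
  induction n with
  | zero => simp [gtCount]
  | succ n ih =>
    rw [det_choose_succ v hv, gtCount, Nat.cast_sum]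
    refine sum_congr rfl fun u hu => ih u ?_
    simp only [Fintype.mem_piFinset, mem_Ico] at hu
    intro i j hij
    rcases hij.eq_or_lt with rfl | hij
    · rfl
    · exact ((hu i).2.trans_le (hv (Fin.succ_le_castSucc_iff.2 hij))).le.trans (hu j).1

theorem det_vandermonde_natCast {n : ℕ} (v : Fin n → ℕ) :
    (Matrix.vandermonde fun i => (v i : ℚ)).det =
      (∏ i : Fin n, ((i : ℕ).factorial : ℚ)) *
        (Matrix.of fun i j : Fin n => ((v i).choose j : ℚ)).det := by
  rw [Matrix.det_eval_matrixOfPolynomials_eq_det_vandermonde _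
    (fun i => descPochhammer ℚ i) (fun i => descPochhammer_natDegree ℚ i)
    (fun i => monic_descPochhammer ℚ i), ← Matrix.det_mul_row]
  congr 1
  ext i j
  simp [descPochhammer_eval_eq_descFactorial, Nat.descFactorial_eq_factorial_mul_choose]

/-- The Cauchy–Binet formula. -/
theorem det_mul_eq_sum_strictMono {R : Type*} [CommRing R] {m N : ℕ}
    (A : Matrix (Fin m) (Fin N) R) (B : Matrix (Fin N) (Fin m) R) :
    (A * B).det = ∑ f : Fin m → Fin N with StrictMono f,
      (A.submatrix id f).det * (B.submatrix f id).det := by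
  have h := (Matrix.detRowAlternating (R := R) (n := Fin m)).toMultilinearMap.map_sum
    (fun (i : Fin m) (k : Fin N) => A i k • B k)
  have h1 : (A * B).det = ∑ f : Fin m → Fin N, (∏ i, A i (f i)) * (B.submatrix f id).det := by
    trans ((Matrix.detRowAlternating (R := R) (n := Fin m)).toMultilinearMap
      fun i => ∑ k, A i k • B k)
    · change _ = Matrix.det _
      congr 1
      ext i j
      simp [Matrix.mul_apply]
    · rw [h]
      refine sum_congr rfl fun f _ => ?_
      exact MultilinearMap.map_smul_univ _ (fun i => A i (f i)) fun i => B (f i)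
  have h2 : ∀ f : Fin m → Fin N, (A.submatrix id f).det * (B.submatrix f id).det =
      ∑ σ : Equiv.Perm (Fin m), (∏ i, A i (f (σ i))) * (B.submatrix (f ∘ σ) id).det := by
    intro f
    rw [← Matrix.det_transpose, Matrix.det_apply, sum_mul]
    refine sum_congr rfl fun σ _ => ?_
    have : (B.submatrix (f ∘ σ) id).det = Equiv.Perm.sign σ * (B.submatrix f id).det := by
      rw [← Matrix.det_permute]
      rfl
    rw [this]
    simp [Units.smul_def]
    ring
  rw [h1, sum_congr rfl fun f _ => h2 f, sum_sigma']
  symm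
  refine sum_of_injOn (fun p => p.1 ∘ p.2) ?_ (by simp) ?_ (fun _ _ => rfl)
  · rintro ⟨f, σ⟩ hf ⟨g, τ⟩ hg hfg
    simp only [coe_sigma, Set.mem_sigma_iff, mem_univ, true_and,
      coe_filter, Set.mem_ofPred_eq, coe_univ, Set.mem_univ, and_true] at hf hg
    have hfg : f ∘ σ = g ∘ τ := hfg
    have hr : f = g := by
      have h3 : f = g ∘ (τ * σ⁻¹ : Equiv.Perm (Fin m)) := by
        ext i
        have := congrFun hfg (σ⁻¹ i)
        simp at this
        simp [this]
      have h4 : Set.range f = Set.range g := by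
        rw [h3, EquivLike.range_comp]
      exact (StrictMono.range_inj hf hg).1 h4
    subst hr
    have : σ = τ := Equiv.ext fun i => hf.injective (congrFun hfg i)
    rw [this]
  · intro f _ hf
    by_cases hi : Function.Injective f
    · refine absurd ?_ hf
      refine ⟨⟨f ∘ Tuple.sort f, (Tuple.sort f)⁻¹⟩, ?_, ?_⟩
      · simpa using (Tuple.monotone_sort f).strictMono_of_injective
          (hi.comp (Tuple.sort f).injective)
      · ext i
        simp
    · rw [Function.not_injective_iff] at hi
      obtain ⟨i, j, hij, hne⟩ := hi
      rw [Matrix.det_zero_of_row_eq hne (by ext; simp [hij]), mul_zero]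

theorem prod_sq_sub_shift (N k : ℚ) (j : ℕ) :
    (∏ r ∈ range j, ((N + r + 1 / 2) ^ 2 - (k + 1 / 2) ^ 2)) * ((N + j + 1 + k) * (N - 1 - k)) =
      (∏ r ∈ range j, ((N + r + 1 / 2) ^ 2 - (k + 1 + 1 / 2) ^ 2)) *
        ((N + k + 1) * (N + j - k - 1)) := by
  induction j with
  | zero => simp; ring
  | succ j ih =>
    rw [prod_range_succ, prod_range_succ]
    push_cast
    linear_combination ((N + j - k) * (N + j + 2 + k)) * ih

theorem sum_mul_prod_sq_sub (N : ℚ) (j n : ℕ) :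
    (j + 1) * ∑ k ∈ range n,
      (2 * (k : ℚ) + 1) * ∏ r ∈ range j, ((N + r + 1 / 2) ^ 2 - ((k : ℚ) + 1 / 2) ^ 2) =
    (∏ r ∈ range j, ((N + r + 1 / 2) ^ 2 - (0 + 1 / 2) ^ 2)) * (N * (N + j)) -
    (∏ r ∈ range j, ((N + r + 1 / 2) ^ 2 - ((n : ℚ) + 1 / 2) ^ 2)) *
      ((N + n) * (N + j - n)) := by
  induction n with
  | zero => simp
  | succ n ih =>
    rw [sum_range_succ, mul_add, ih]
    have := prod_sq_sub_shift N n j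
    push_cast
    linear_combination -this

theorem prod_sq_sub_half (M j : ℕ) :
    (∏ r ∈ range j, (((M + 1 : ℕ) + r + 1 / 2 : ℚ) ^ 2 - (0 + 1 / 2) ^ 2)) *
      ((M + 1 + j) * (M + 1) * (M.factorial : ℚ) ^ 2) = ((M + 1 + j).factorial : ℚ) ^ 2 := by
  induction j with
  | zero => simp [Nat.factorial_succ]; ring
  | succ j ih =>
    rw [prod_range_succ, ← add_assoc, Nat.factorial_succ]
    push_cast at ih ⊢
    linear_combination ((M + 1 + j + 1 : ℚ) ^ 2) * ih

theorem cast_descFactorial_succ (M i : ℕ) :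
    (M.descFactorial (i + 1) : ℚ) = (M - i) * M.descFactorial i := by
  rw [Nat.descFactorial_succ]
  rcases le_or_gt i M with h | h
  · push_cast [h]
    rfl
  · simp [Nat.descFactorial_eq_zero_iff_lt.2 h]

/-- The moments of the weight `2k + 1` in the bases adapted to the two ends of the interval. -/
theorem sum_mul_prod_mul_prod (M i j : ℕ) :
    (∑ k ∈ range (M + 1), (2 * (k : ℚ) + 1) *
      (∏ r ∈ range i, (((k : ℚ) + 1 / 2) ^ 2 - (r + 1 / 2) ^ 2)) *
      ∏ r ∈ range j, (((M + 1 : ℕ) + r + 1 / 2 : ℚ) ^ 2 - ((k : ℚ) + 1 / 2) ^ 2)) *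
      ((i + j + 1).factorial * (M.factorial : ℚ) ^ 2) =
    i.factorial * j.factorial * (M + 1 + j).factorial * M.descFactorial i *
      (M + 1 + i + j).factorial := by
  induction i generalizing j with
  | zero =>
    have h := sum_mul_prod_sq_sub (M + 1 : ℕ) j (M + 1)
    have h2 := prod_sq_sub_half M j
    have h3 : (∏ r ∈ range j, (((M + 1 : ℕ) + r + 1 / 2 : ℚ) ^ 2 -
        (((M + 1 : ℕ) : ℚ) + 1 / 2) ^ 2)) * ((M + 1 : ℕ) + j - (M + 1 : ℕ)) = (0 : ℚ) := by
      rcases j with _ | j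
      · simp
      · rw [prod_range_succ', Nat.cast_zero, add_zero, sub_self, mul_zero, zero_mul]
    simp only [range_zero, prod_empty, mul_one, zero_add, Nat.factorial_zero, Nat.cast_one,
      one_mul, Nat.descFactorial_zero, Nat.factorial_succ j, add_zero]
    push_cast at h h2 h3 ⊢
    linear_combination ((j.factorial : ℚ) * (M.factorial : ℚ) ^ 2) * h
      + (j.factorial : ℚ) * h2 - ((j.factorial : ℚ) * (M.factorial : ℚ) ^ 2 * (M + 1 + (M + 1))) * h3
  | succ i ih =>
    have h1 := ih j
    have h2 := ih (j + 1)
    simp only [prod_range_succ] at h2 ⊢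
    rw [show i + (j + 1) + 1 = i + j + 1 + 1 by ring, Nat.factorial_succ (i + j + 1),
      Nat.factorial_succ j, show M + 1 + (j + 1) = M + 1 + j + 1 by ring,
      Nat.factorial_succ (M + 1 + j), show M + 1 + i + (j + 1) = M + 1 + i + j + 1 by ring,
      Nat.factorial_succ (M + 1 + i + j)] at h2
    rw [show i + 1 + j + 1 = i + j + 1 + 1 by ring, Nat.factorial_succ (i + j + 1),
      Nat.factorial_succ i, cast_descFactorial_succ,
      show M + 1 + (i + 1) + j = M + 1 + i + j + 1 by ring, Nat.factorial_succ (M + 1 + i + j)]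
    have h3 : ∀ k : ℕ, (2 * (k : ℚ) + 1) *
        ((∏ r ∈ range i, (((k : ℚ) + 1 / 2) ^ 2 - (r + 1 / 2) ^ 2)) *
          (((k : ℚ) + 1 / 2) ^ 2 - (i + 1 / 2) ^ 2)) *
        ∏ r ∈ range j, (((M + 1 : ℕ) + r + 1 / 2 : ℚ) ^ 2 - ((k : ℚ) + 1 / 2) ^ 2) =
        ((M + 1 + j - i) * (M + 1 + j + i + 1)) * ((2 * (k : ℚ) + 1) *
      (∏ r ∈ range i, (((k : ℚ) + 1 / 2) ^ 2 - (r + 1 / 2) ^ 2)) *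
      ∏ r ∈ range j, (((M + 1 : ℕ) + r + 1 / 2 : ℚ) ^ 2 - ((k : ℚ) + 1 / 2) ^ 2)) -
       (2 * (k : ℚ) + 1) * (∏ r ∈ range i, (((k : ℚ) + 1 / 2) ^ 2 - (r + 1 / 2) ^ 2)) *
      ((∏ r ∈ range j, (((M + 1 : ℕ) + r + 1 / 2 : ℚ) ^ 2 - ((k : ℚ) + 1 / 2) ^ 2)) *
        (((M + 1 : ℕ) + j + 1 / 2 : ℚ) ^ 2 - ((k : ℚ) + 1 / 2) ^ 2)) := by
      intro k
      push_cast
      ring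
    rw [sum_congr rfl fun k _ => h3 k, sum_sub_distrib, ← mul_sum, sub_mul]
    push_cast at h1 h2 ⊢
    linear_combination ((M + 1 + j - i) * (M + 1 + j + i + 1) * (i + j + 1 + 1) : ℚ) * h1 - h2

theorem det_vandermonde_fin (x : ℕ) :
    (Matrix.vandermonde fun i : Fin x => ((i : ℕ) : ℚ)).det =
      ∏ i : Fin x, ((i : ℕ).factorial : ℚ) := by
  rw [det_vandermonde_natCast fun i : Fin x => (i : ℕ), Matrix.det_of_isLowerTriangular]
  · simp
  · intro i j hij
    simpa using Nat.choose_eq_zero_of_lt (show (i : ℕ) < j from hij)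

theorem abs_det_inv_factorial (x : ℕ) :
    |(Matrix.of fun s j : Fin x => (((j + s + 1 : ℕ).factorial : ℚ))⁻¹).det| =
      ∏ j : Fin x, ((j : ℕ).factorial / (x + j).factorial : ℚ) := by
  have h1 := Matrix.det_eval_matrixOfPolynomials_eq_det_vandermonde
    (fun j : Fin x => ((j : ℕ) : ℚ) + x)
    (fun i => descPochhammer ℚ i) (fun i => descPochhammer_natDegree ℚ i)
    (fun i => monic_descPochhammer ℚ i)
  rw [Matrix.det_vandermonde_add, det_vandermonde_fin] at h1
  have h2 : (Matrix.of fun i j : Fin x => (descPochhammer ℚ j).eval (((i : ℕ) : ℚ) + x)) =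
      (Matrix.of fun j s : Fin x => ((x + j).factorial : ℚ) *
        (Matrix.of fun s j : Fin x => (((j + s + 1 : ℕ).factorial : ℚ))⁻¹).transpose j s).submatrix
        (Equiv.refl _) Fin.revPerm := by
    ext j s
    have hs := s.2
    simp only [Matrix.of_apply, Matrix.submatrix_apply, Matrix.transpose_apply, Equiv.refl_apply,
      Fin.revPerm_apply, Fin.val_rev]
    rw [← Nat.cast_add, descPochhammer_eval_eq_descFactorial,
      Nat.descFactorial_eq_div (by lia), Nat.cast_div (Nat.factorial_dvd_factorial (by lia))
        (by positivity), div_eq_mul_inv, add_comm x,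
      show (j : ℕ) + x - s = j + (x - (s + 1)) + 1 by lia]
  have h3 := congrArg abs h1
  rw [h2, Matrix.abs_det_submatrix_equiv_equiv, Matrix.det_mul_column, Matrix.det_transpose,
    abs_mul, abs_of_nonneg (prod_nonneg fun _ _ => by positivity),
    abs_of_nonneg (prod_nonneg fun _ _ => by positivity)] at h3
  rw [prod_div_distrib, h3, mul_div_cancel_left₀]
  exact (prod_pos fun _ _ => by positivity).ne'

theorem choose_add_eq_sum {M x : ℕ} (hx : x ≤ M + 1) (i j : Fin x) :
    ((M + 1 + i + j).choose M : ℚ) =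
      ∑ s : Fin x, ((i : ℕ).choose s : ℚ) * (M + 1 + j).choose (M - s) := by
  rw [show M + 1 + i + j = i + (M + 1 + j) by ring, Nat.add_choose_eq,
    Nat.sum_antidiagonal_eq_sum_range_succ_mk,
    Fin.sum_univ_eq_sum_range fun s : ℕ => (((i : ℕ).choose s : ℚ) * (M + 1 + j).choose (M - s))]
  push_cast
  symm
  refine sum_subset (by simpa using hx) fun s _ hs => ?_
  rw [Nat.choose_eq_zero_of_lt (by have := i.2; simp at hs; lia)]
  simp

theorem abs_det_choose {M x : ℕ} (hx : x ≤ M + 1) :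
    |(Matrix.of fun i j : Fin x => ((M + 1 + i + j).choose M : ℚ)).det| =
      ∏ j : Fin x, ((M + 1 + j).factorial / (M - j).factorial *
        ((j : ℕ).factorial / (x + j).factorial) : ℚ) := by
  have h1 : (Matrix.of fun i j : Fin x => ((M + 1 + i + j).choose M : ℚ)) =
      (Matrix.of fun i j : Fin x => ((i : ℕ).choose j : ℚ)) *
      (Matrix.of fun s j : Fin x => ((M + 1 + j).factorial : ℚ) *
        (Matrix.of fun s j : Fin x => ((M - s).factorial : ℚ)⁻¹ *
          (Matrix.of fun s j : Fin x => (((j + s + 1 : ℕ).factorial : ℚ))⁻¹) s j) s j) := by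
    ext i j
    rw [Matrix.of_apply, choose_add_eq_sum hx, Matrix.mul_apply]
    refine sum_congr rfl fun s _ => ?_
    have hs := s.2
    simp only [Matrix.of_apply]
    rw [Nat.cast_choose ℚ (by lia : M - s ≤ M + 1 + j),
      show M + 1 + j - (M - s) = (j : ℕ) + s + 1 by lia]
    field_simp
  have h2 : (Matrix.of fun i j : Fin x => ((i : ℕ).choose j : ℚ)).det = 1 := by
    rw [Matrix.det_of_isLowerTriangular]
    · simp
    · intro i j hij
      simpa using Nat.choose_eq_zero_of_lt (show (i : ℕ) < j from hij)
  rw [h1, Matrix.det_mul, h2, one_mul, Matrix.det_mul_row, Matrix.det_mul_column, abs_mul, abs_mul,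
    abs_det_inv_factorial, abs_of_nonneg (prod_nonneg fun _ _ => by positivity),
    abs_of_nonneg (prod_nonneg fun _ _ => by positivity), prod_mul_distrib, ← mul_assoc]
  simp only [div_eq_mul_inv, prod_mul_distrib]

theorem abs_det_moments {M x : ℕ} (hx : x ≤ M + 1) :
    |(Matrix.of fun i j : Fin x => ∑ k ∈ range (M + 1), (2 * (k : ℚ) + 1) *
      (∏ r ∈ range i, (((k : ℚ) + 1 / 2) ^ 2 - (r + 1 / 2) ^ 2)) *
      ∏ r ∈ range j, (((M + 1 : ℕ) + r + 1 / 2 : ℚ) ^ 2 - ((k : ℚ) + 1 / 2) ^ 2)).det| =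
    ∏ i : Fin x, ((i : ℕ).factorial ^ 3 * (M + 1 + i).factorial ^ 2 /
      ((M - i).factorial ^ 2 * (x + i).factorial) : ℚ) := by
  have h1 : (Matrix.of fun i j : Fin x => ∑ k ∈ range (M + 1), (2 * (k : ℚ) + 1) *
      (∏ r ∈ range i, (((k : ℚ) + 1 / 2) ^ 2 - (r + 1 / 2) ^ 2)) *
      ∏ r ∈ range j, (((M + 1 : ℕ) + r + 1 / 2 : ℚ) ^ 2 - ((k : ℚ) + 1 / 2) ^ 2)) =
      Matrix.of fun i j : Fin x => ((i : ℕ).factorial * M.descFactorial i : ℚ) *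
        (Matrix.of fun i j : Fin x => ((j : ℕ).factorial * (M + 1 + j).factorial / M.factorial : ℚ) *
        (Matrix.of fun i j : Fin x => ((M + 1 + i + j).choose M : ℚ)) i j) i j := by
    ext i j
    have h := sum_mul_prod_mul_prod M i j
    simp only [Matrix.of_apply]
    rw [Nat.cast_choose ℚ (by lia : M ≤ M + 1 + i + j),
      show M + 1 + i + j - M = (i : ℕ) + j + 1 by lia]
    rw [← eq_div_iff (by positivity)] at h
    rw [h]
    field_simp
  rw [h1, Matrix.det_mul_column, Matrix.det_mul_row, abs_mul, abs_mul, abs_det_choose hx,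
    abs_of_nonneg (prod_nonneg fun _ _ => by positivity),
    abs_of_nonneg (prod_nonneg fun _ _ => by positivity), ← prod_mul_distrib, ← prod_mul_distrib]
  refine prod_congr rfl fun i _ => ?_
  have hi := i.2
  rw [Nat.descFactorial_eq_div (by lia), Nat.cast_div (Nat.factorial_dvd_factorial (by lia))
    (by positivity)]
  field_simp

theorem det_vandermonde_eq_prod {R : Type*} [CommRing R] [Nontrivial R] {x : ℕ}
    (z : Fin x → R) (c : ℕ → R) :
    (Matrix.vandermonde z).det =
      (Matrix.of fun i j : Fin x => ∏ r ∈ range j, (z i - c r)).det := by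
  rw [Matrix.det_eval_matrixOfPolynomials_eq_det_vandermonde z
    (fun j => ∏ r ∈ range j, (Polynomial.X - Polynomial.C (c r)))
    (fun j => by simp [Polynomial.natDegree_prod_of_monic, Polynomial.monic_X_sub_C])
    (fun j => Polynomial.monic_prod_of_monic _ _ fun r _ => Polynomial.monic_X_sub_C _)]
  simp [Polynomial.eval_prod]

theorem sum_strictMono_vandermonde_sq {M x : ℕ} (hx : x ≤ M + 1) :
    ∑ f : Fin x → Fin (M + 1) with StrictMono f, (∏ i, (2 * ((f i : ℕ) : ℚ) + 1)) *
      (Matrix.vandermonde fun i => (((f i : ℕ) : ℚ) + 1 / 2) ^ 2).det ^ 2 =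
    ∏ i : Fin x, ((i : ℕ).factorial ^ 3 * (M + 1 + i).factorial ^ 2 /
      ((M - i).factorial ^ 2 * (x + i).factorial) : ℚ) := by
  rw [← abs_det_moments hx]
  refine (abs_of_nonneg (sum_nonneg fun f _ =>
    mul_nonneg (prod_nonneg fun i _ => by positivity) (sq_nonneg _))).symm.trans ?_
  have h1 := det_mul_eq_sum_strictMono
    (Matrix.of fun (i : Fin x) (k : Fin (M + 1)) =>
      ∏ r ∈ range i, ((((k : ℕ) : ℚ) + 1 / 2) ^ 2 - (r + 1 / 2) ^ 2))
    (Matrix.of fun (k : Fin (M + 1)) (j : Fin x) => (2 * ((k : ℕ) : ℚ) + 1) *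
      ∏ r ∈ range j, ((((k : ℕ) : ℚ) + 1 / 2) ^ 2 - ((M + 1 : ℕ) + r + 1 / 2) ^ 2))
  have h2 : ∀ f : Fin x → Fin (M + 1), (∏ i, (2 * ((f i : ℕ) : ℚ) + 1)) *
      (Matrix.vandermonde fun i => (((f i : ℕ) : ℚ) + 1 / 2) ^ 2).det ^ 2 =
    ((Matrix.of fun (i : Fin x) (k : Fin (M + 1)) =>
      ∏ r ∈ range i, ((((k : ℕ) : ℚ) + 1 / 2) ^ 2 - (r + 1 / 2) ^ 2)).submatrix id f).det *
    ((Matrix.of fun (k : Fin (M + 1)) (j : Fin x) => (2 * ((k : ℕ) : ℚ) + 1) *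
      ∏ r ∈ range j, ((((k : ℕ) : ℚ) + 1 / 2) ^ 2 -
        ((M + 1 : ℕ) + r + 1 / 2) ^ 2)).submatrix f id).det := by
    intro f
    have h3 := det_vandermonde_eq_prod (fun i => (((f i : ℕ) : ℚ) + 1 / 2) ^ 2)
      (fun r => ((r : ℚ) + 1 / 2) ^ 2)
    have h4 := det_vandermonde_eq_prod (fun i => (((f i : ℕ) : ℚ) + 1 / 2) ^ 2)
      (fun r => (((M + 1 : ℕ) : ℚ) + r + 1 / 2) ^ 2)
    rw [sq, mul_left_comm]
    refine congrArg₂ _ (h3.trans (Matrix.det_transpose _).symm) ?_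
    rw [h4, ← Matrix.det_mul_column]
    rfl
  rw [sum_congr rfl fun f _ => h2 f, ← h1]
  have h5 : (Matrix.of fun i j : Fin x => ∑ k ∈ range (M + 1), (2 * (k : ℚ) + 1) *
      (∏ r ∈ range i, (((k : ℚ) + 1 / 2) ^ 2 - (r + 1 / 2) ^ 2)) *
      ∏ r ∈ range j, (((M + 1 : ℕ) + r + 1 / 2 : ℚ) ^ 2 - ((k : ℚ) + 1 / 2) ^ 2)) =
      Matrix.of fun i j : Fin x => (-1 : ℚ) ^ (j : ℕ) * ((Matrix.of fun (i : Fin x) (k : Fin (M + 1)) =>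
      ∏ r ∈ range i, ((((k : ℕ) : ℚ) + 1 / 2) ^ 2 - (r + 1 / 2) ^ 2)) *
    (Matrix.of fun (k : Fin (M + 1)) (j : Fin x) => (2 * ((k : ℕ) : ℚ) + 1) *
      ∏ r ∈ range j, ((((k : ℕ) : ℚ) + 1 / 2) ^ 2 - ((M + 1 : ℕ) + r + 1 / 2) ^ 2)) :
        Matrix (Fin x) (Fin x) ℚ) i j := by
    ext i j
    simp only [Matrix.of_apply, Matrix.mul_apply]
    rw [mul_sum, ← Fin.sum_univ_eq_sum_range fun k : ℕ => (2 * (k : ℚ) + 1) *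
      (∏ r ∈ range i, (((k : ℚ) + 1 / 2) ^ 2 - (r + 1 / 2) ^ 2)) *
      ∏ r ∈ range j, (((M + 1 : ℕ) + r + 1 / 2 : ℚ) ^ 2 - ((k : ℚ) + 1 / 2) ^ 2)]
    refine sum_congr rfl fun k _ => ?_
    have h6 : ∏ r ∈ range j, (((M + 1 : ℕ) + r + 1 / 2 : ℚ) ^ 2 - (((k : ℕ) : ℚ) + 1 / 2) ^ 2) =
        (-1) ^ (j : ℕ) *
        ∏ r ∈ range j, ((((k : ℕ) : ℚ) + 1 / 2) ^ 2 - ((M + 1 : ℕ) + r + 1 / 2) ^ 2) := by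
      rw [← card_range (j : ℕ), ← prod_const, card_range, ← prod_mul_distrib]
      exact prod_congr rfl fun r _ => by ring
    rw [h6]
    ring
  rw [h5, Matrix.det_mul_row, abs_mul, abs_prod]
  simp

theorem PP_eq_prod_factorial (a b c : ℕ) :
    PP a b c = ∏ i ∈ range a, ((i.factorial * (b + c + i).factorial : ℚ) /
      ((c + i).factorial * (b + i).factorial)) := by
  have hIcc : ∀ (n : ℕ) (F : ℕ → ℚ), ∏ i ∈ Icc 1 n, F i = ∏ i ∈ range n, F (i + 1) := by
    intro n F
    rw [range_eq_Ico, prod_Ico_add' F 0 n 1]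
    rfl
  have hk : ∀ i j : ℕ, ∏ k ∈ range c,
      ((((i + 1 : ℕ) : ℚ) + (j + 1 : ℕ) + (k + 1 : ℕ) - 1) /
        (((i + 1 : ℕ) : ℚ) + (j + 1 : ℕ) + (k + 1 : ℕ) - 2)) =
      (i + j + c + 1 : ℚ) / (i + j + 1) := by
    intro i j
    induction c with
    | zero => simp; rw [div_self (by positivity)]
    | succ c ih =>
      rw [prod_range_succ, ih]
      push_cast
      rw [show (i + 1 + (j + 1) + (c + 1) - 2 : ℚ) = i + j + c + 1 by ring,
        div_mul_div_cancel₀' (by positivity)]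
      congr 1
      ring
  have hj : ∀ i : ℕ, ∏ j ∈ range b, ((i + j + c + 1 : ℚ) / (i + j + 1)) =
      (i.factorial * (b + c + i).factorial : ℚ) / ((c + i).factorial * (b + i).factorial) := by
    intro i
    induction b with
    | zero => simp; rw [mul_comm, div_self (by positivity)]
    | succ b ih =>
      rw [prod_range_succ, ih, show b + 1 + c + i = b + c + i + 1 by ring,
        show b + 1 + i = b + i + 1 by ring, Nat.factorial_succ, Nat.factorial_succ]
      push_cast
      field_simp
      ring
  simp only [PP, hIcc, hk, hj]

theorem prod_moments_eq (x y : ℕ) (hx : 0 < x) :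
    ∏ i : Fin x, ((i : ℕ).factorial ^ 3 * (x + y - 1 + 1 + i).factorial ^ 2 /
      ((x + y - 1 - i).factorial ^ 2 * (x + i).factorial) : ℚ) =
    PP x x y ^ 2 * ∏ i ∈ range (2 * x), (i.factorial : ℚ) := by
  rw [Fin.prod_univ_eq_prod_range fun i : ℕ => (i.factorial ^ 3 *
    (x + y - 1 + 1 + i).factorial ^ 2 / ((x + y - 1 - i).factorial ^ 2 * (x + i).factorial) : ℚ),
    PP_eq_prod_factorial, two_mul, prod_range_add, ← prod_pow, ← prod_mul_distrib,
    ← prod_mul_distrib]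
  have h : ∏ i ∈ range x, ((x + y - 1 - i).factorial : ℚ) = ∏ i ∈ range x, ((y + i).factorial : ℚ) := by
    rw [← prod_range_reflect]
    refine prod_congr rfl fun i hi => ?_
    rw [mem_range] at hi
    rw [show x + y - 1 - (x - 1 - i) = y + i by lia]
  simp only [prod_div_distrib, prod_mul_distrib, prod_pow, h, div_pow, mul_pow,
    show x + y - 1 + 1 = x + y by lia]
  have h0 : ∀ n : ℕ, ∏ i ∈ range x, ((n + i).factorial : ℚ) ≠ 0 := fun n =>
    (prod_pos fun _ _ => by positivity).ne'
  have h1 := h0 x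
  have h2 := h0 y
  field_simp

/-- The indices of a row of length `2x`, as the right half together with the reversed left half. -/
noncomputable def halvesEquiv (x : ℕ) : Fin x ⊕ Fin x ≃ Fin (2 * x) :=
  Equiv.ofBijective
    (Sum.elim (fun i => ⟨x + i, by lia⟩) (fun i => ⟨x - 1 - i, by lia⟩)) <| by
    rw [Fintype.bijective_iff_injective_and_card]
    refine ⟨?_, by simp [two_mul]⟩
    rintro (i | i) (j | j) h <;> simp [Fin.ext_iff] at h ⊢ <;> lia

@[simp]
theorem halvesEquiv_inl_val {x : ℕ} (i : Fin x) : (halvesEquiv x (.inl i) : ℕ) = x + i := rfl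

@[simp]
theorem halvesEquiv_inr_val {x : ℕ} (i : Fin x) : (halvesEquiv x (.inr i) : ℕ) = x - 1 - i := rfl

/-- The indices of a row of length `2x`, as the even ones together with the odd ones. -/
noncomputable def evenOddEquiv (x : ℕ) : Fin x ⊕ Fin x ≃ Fin (2 * x) :=
  Equiv.ofBijective
    (Sum.elim (fun i => ⟨2 * i, by lia⟩) (fun i => ⟨2 * i + 1, by lia⟩)) <| by
    rw [Fintype.bijective_iff_injective_and_card]
    refine ⟨?_, by simp [two_mul]⟩
    rintro (i | i) (j | j) h <;> simp [Fin.ext_iff] at h ⊢ <;> lia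

@[simp]
theorem evenOddEquiv_inl_val {x : ℕ} (i : Fin x) : (evenOddEquiv x (.inl i) : ℕ) = 2 * i := rfl

@[simp]
theorem evenOddEquiv_inr_val {x : ℕ} (i : Fin x) : (evenOddEquiv x (.inr i) : ℕ) = 2 * i + 1 := rfl

theorem abs_det_vandermonde_symm {x : ℕ} (w : Fin (2 * x) → ℚ) (m : Fin x → ℚ)
    (h₁ : ∀ i, w (halvesEquiv x (.inl i)) = m i) (h₂ : ∀ i, w (halvesEquiv x (.inr i)) = -m i) :
    |(Matrix.vandermonde w).det| =
      |∏ i, (2 * m i)| * (Matrix.vandermonde fun i => m i ^ 2).det ^ 2 := by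
  rw [← Matrix.abs_det_submatrix_equiv_equiv (halvesEquiv x) (evenOddEquiv x)]
  set E := Matrix.vandermonde fun i => m i ^ 2
  have hE : (Matrix.vandermonde w).submatrix (halvesEquiv x) (evenOddEquiv x) =
      Matrix.fromBlocks 1 0 1 1 * Matrix.fromBlocks E (Matrix.of fun i j => m i * E i j)
        0 (Matrix.of fun i j => (-(2 * m i)) * E i j) := by
    rw [Matrix.fromBlocks_multiply]
    ext (i | i) (j | j) <;>
      simp [h₁, h₂, E, Matrix.vandermonde_apply, pow_mul, pow_succ']
    ring
  rw [hE, Matrix.det_mul, Matrix.det_fromBlocks_zero₁₂, Matrix.det_fromBlocks_zero₂₁,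
    Matrix.det_mul_column, prod_neg]
  simp only [Matrix.det_one, one_mul, abs_mul, abs_pow, abs_neg, abs_one, one_pow]
  rw [← sq_abs E.det]
  ring

/-- The self-complementary row of length `2x` whose right half is `N + f`. -/
noncomputable def symmRow {x N : ℕ} (f : Fin x → Fin N) (i : Fin (2 * x)) : ℕ :=
  Sum.elim (fun i => N + f i) (fun i => N - 1 - f i) ((halvesEquiv x).symm i)

@[simp]
theorem symmRow_inl {x N : ℕ} (f : Fin x → Fin N) (i : Fin x) :
    symmRow f (halvesEquiv x (.inl i)) = N + f i := by
  simp [symmRow]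

@[simp]
theorem symmRow_inr {x N : ℕ} (f : Fin x → Fin N) (i : Fin x) :
    symmRow f (halvesEquiv x (.inr i)) = N - 1 - f i := by
  simp [symmRow]

theorem symmRow_monotone {x N : ℕ} {f : Fin x → Fin N} (hf : StrictMono f) :
    Monotone (symmRow f) := by
  intro i j hij
  obtain ⟨a, rfl⟩ := (halvesEquiv x).surjective i
  obtain ⟨b, rfl⟩ := (halvesEquiv x).surjective j
  rcases a with a | a <;> rcases b with b | b <;> rw [Fin.le_def] at hij <;> simp at hij ⊢
  · exact hf.monotone hij
  · lia
  · lia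
  · have := hf.monotone (show b ≤ a by rw [Fin.le_def]; lia)
    rw [Fin.le_def] at this
    lia

theorem gtCount_symmRow {x N : ℕ} {f : Fin x → Fin N} (hf : StrictMono f) :
    (gtCount (2 * x) (symmRow f) : ℚ) * ∏ i ∈ range (2 * x), (i.factorial : ℚ) =
      (∏ i, (2 * ((f i : ℕ) : ℚ) + 1)) *
      (Matrix.vandermonde fun i => (((f i : ℕ) : ℚ) + 1 / 2) ^ 2).det ^ 2 := by
  rw [gtCount_eq_det _ (symmRow_monotone hf), mul_comm,
    ← Fin.prod_univ_eq_prod_range fun i => (i.factorial : ℚ), ← det_vandermonde_natCast,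
    ← abs_of_nonneg (a := Matrix.det _), ← Matrix.det_vandermonde_sub _ ((N : ℚ) - 1 / 2),
    abs_det_vandermonde_symm _ fun i => ((f i : ℕ) : ℚ) + 1 / 2]
  · congr 1
    rw [abs_of_nonneg (prod_nonneg fun i _ => by positivity)]
    exact prod_congr rfl fun i _ => by ring
  · intro i
    simp
  · intro i
    have := (f i).2
    rw [symmRow_inr, Nat.cast_sub (by lia), Nat.cast_sub (by lia)]
    push_cast
    ring
  · rw [det_vandermonde_natCast, ← gtCount_eq_det _ (symmRow_monotone hf)]
    positivity

/-- Gelfand–Tsetlin patterns in strict form: row `t` has entries `g t i` for `t + i < n`. -/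
structure IsGTPattern (n : ℕ) (g : ℕ → ℕ → ℕ) : Prop where
  eq_zero : ∀ t i, n ≤ t + i → g t i = 0
  le : ∀ t i, t + 1 + i < n → g t i ≤ g (t + 1) i
  lt : ∀ t i, t + 1 + i < n → g (t + 1) i < g t (i + 1)

/-- The Gelfand–Tsetlin patterns with top row `v`. -/
abbrev GTPatternWithRow (n : ℕ) (v : Fin n → ℕ) : Type :=
  {g : ℕ → ℕ → ℕ // IsGTPattern n g ∧ ∀ i : Fin n, g 0 i = v i}

/-- Add a new top row to a pattern. -/
def consRow {n : ℕ} (v : Fin (n + 1) → ℕ) (g : ℕ → ℕ → ℕ) : ℕ → ℕ → ℕ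
  | 0, i => if h : i < n + 1 then v ⟨i, h⟩ else 0
  | t + 1, i => g t i

theorem exists_bijective_cons {n : ℕ} (v : Fin (n + 1) → ℕ) :
    ∃ φ : (Σ u : Fintype.piFinset fun i : Fin n => Ico (v i.castSucc) (v i.succ),
        GTPatternWithRow n u.1) → GTPatternWithRow (n + 1) v, Function.Bijective φ := by
  refine ⟨fun p => ⟨consRow v p.2.1, ⟨?_, ?_, ?_⟩, ?_⟩, ?_, ?_⟩
  · rintro (_ | t) i hi
    · exact dif_neg (by lia)
    · exact p.2.2.1.eq_zero t i (by lia)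
  · rintro (_ | t) i hi
    · have h1 := p.2.2.2 ⟨i, by lia⟩
      have h2 := p.1.2
      simp only [Fintype.mem_piFinset, mem_Ico] at h2
      simp only [consRow, h1, dif_pos (show i < n + 1 by lia)]
      exact (h2 ⟨i, by lia⟩).1
    · exact p.2.2.1.le t i (by lia)
  · rintro (_ | t) i hi
    · have h1 := p.2.2.2 ⟨i, by lia⟩
      have h2 := p.1.2
      simp only [Fintype.mem_piFinset, mem_Ico] at h2
      simp only [consRow, h1, dif_pos (show i + 1 < n + 1 by lia)]
      exact (h2 ⟨i, by lia⟩).2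
    · exact p.2.2.1.lt t i (by lia)
  · exact fun i => dif_pos i.2
  · rintro ⟨⟨u, hu⟩, ⟨g, hg⟩⟩ ⟨⟨u', hu'⟩, ⟨g', hg'⟩⟩ h
    have hgg : g = g' := by
      funext t
      exact congrFun (congrArg Subtype.val h) (t + 1)
    subst hgg
    have huu : u = u' := funext fun i => (hg.2 i).symm.trans (hg'.2 i)
    subst huu
    rfl
  · rintro ⟨g, hg, hv⟩
    refine ⟨⟨⟨fun i => g 1 i, ?_⟩, ⟨fun t => g (t + 1), ⟨?_, ?_, ?_⟩, fun i => rfl⟩⟩, ?_⟩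
    · simp only [Fintype.mem_piFinset, mem_Ico, ← hv]
      exact fun i => ⟨hg.le 0 i (by lia), hg.lt 0 i (by lia)⟩
    · exact fun t i hi => hg.eq_zero _ _ (by lia)
    · exact fun t i hi => hg.le _ _ (by lia)
    · exact fun t i hi => hg.lt _ _ (by lia)
    · refine Subtype.ext (funext fun t => ?_)
      rcases t with _ | t
      · funext i
        by_cases h : i < n + 1
        · exact (dif_pos h).trans (hv ⟨i, h⟩).symm
        · exact (dif_neg h).trans (hg.eq_zero 0 i (by lia)).symm
      · rfl

theorem finite_and_card_GTPatternWithRow {n : ℕ} (v : Fin n → ℕ) :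
    Finite (GTPatternWithRow n v) ∧ Nat.card (GTPatternWithRow n v) = gtCount n v := by
  induction n with
  | zero =>
    have : Unique (GTPatternWithRow 0 v) :=
      { default := ⟨fun _ _ => 0, ⟨by simp, by simp, by simp⟩, fun i => i.elim0⟩
        uniq := fun g => Subtype.ext <| by
          funext t i
          exact g.2.1.eq_zero t i (by lia) }
    exact ⟨inferInstance, by simp [gtCount]⟩
  | succ n ih =>
    obtain ⟨φ, hφ⟩ := exists_bijective_cons v
    have : ∀ u : Fin n → ℕ, Finite (GTPatternWithRow n u) := fun u => (ih u).1
    refine ⟨Finite.of_surjective φ hφ.2, ?_⟩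
    rw [← Nat.card_eq_of_bijective φ hφ, Nat.card_sigma, gtCount]
    simp only [(ih _).2]
    exact sum_coe_sort _ (gtCount n)

/-- Gelfand–Tsetlin patterns whose (shifted) top row is symmetric. -/
abbrev SymmGTPattern (n M : ℕ) : Type :=
  {g : ℕ → ℕ → ℕ // IsGTPattern n g ∧ ∀ i, i < n → g 0 i + g 0 (n - 1 - i) = M + n - 1}

theorem IsGTPattern.lt_row {n : ℕ} {g : ℕ → ℕ → ℕ} (hg : IsGTPattern n g) {i j : ℕ}
    (hij : i < j) (hj : j < n) : g 0 i < g 0 j := by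
  induction j, hij using Nat.le_induction with
  | base => exact (hg.le 0 i (by lia)).trans_lt (hg.lt 0 i (by lia))
  | succ j hj' ih =>
    exact (ih (by lia)).trans ((hg.le 0 j (by lia)).trans_lt (hg.lt 0 j (by lia)))

theorem card_SymmGTPattern {x y M N : ℕ} (hM : M = 2 * y) (hN : N = x + y) :
    Nat.card (SymmGTPattern (2 * x) M) =
      ∑ f : Fin x → Fin N with StrictMono f, gtCount (2 * x) (symmRow f) := by
  have hfin : ∀ f : Fin x → Fin N, Finite (GTPatternWithRow (2 * x) (symmRow f)) :=
    fun f => (finite_and_card_GTPatternWithRow _).1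
  let φ : (Σ f : (univ.filter StrictMono : Finset (Fin x → Fin N)),
      GTPatternWithRow (2 * x) (symmRow f.1)) → SymmGTPattern (2 * x) M :=
    fun p => ⟨p.2.1, p.2.2.1, fun i hi => by
      obtain ⟨a, ha⟩ := (halvesEquiv x).surjective ⟨i, hi⟩
      have h := p.2.2.2
      rcases a with a | a
      all_goals
        have h1 := h (halvesEquiv x (.inl a))
        have h2 := h (halvesEquiv x (.inr a))
        have h3 := (p.1.1 a).2
        simp only [halvesEquiv_inl_val, halvesEquiv_inr_val, symmRow_inl, symmRow_inr] at h1 h2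
        have h4 := congrArg Fin.val ha
        simp only [halvesEquiv_inl_val, halvesEquiv_inr_val] at h4
        subst h4
      · rw [show 2 * x - 1 - (x + (a : ℕ)) = x - 1 - a by lia, h1, h2]
        lia
      · rw [show 2 * x - 1 - (x - 1 - (a : ℕ)) = x + a by lia, h1, h2]
        lia⟩
  have hφ : Function.Bijective φ := by
    constructor
    · rintro ⟨⟨f, hf⟩, ⟨g, hg⟩⟩ ⟨⟨f', hf'⟩, ⟨g', hg'⟩⟩ h
      have hgg : g = g' := congrArg Subtype.val h
      subst hgg
      have hff : f = f' := by
        funext i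
        have h1 := hg.2 (halvesEquiv x (.inl i))
        have h2 := hg'.2 (halvesEquiv x (.inl i))
        simp only [symmRow_inl] at h1 h2
        exact Fin.ext (by lia)
      subst hff
      rfl
    · rintro ⟨g, hg, hs⟩
      have hlt : ∀ i : Fin x, N ≤ g 0 (x + i) ∧ g 0 (x + i) - N < N ∧
          g 0 (x - 1 - i) = N - 1 - (g 0 (x + i) - N) := by
        intro i
        have h1 := hg.lt_row (show x - 1 - i < x + i by lia) (by lia)
        have h2 := hs (x + i) (by lia)
        rw [show 2 * x - 1 - (x + (i : ℕ)) = x - 1 - i by lia] at h2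
        lia
      refine ⟨⟨⟨fun i => ⟨g 0 (x + i) - N, (hlt i).2.1⟩, ?_⟩, ⟨g, hg, ?_⟩⟩, rfl⟩
      · simp only [mem_filter, mem_univ, true_and]
        intro i j hij
        have h1 := hg.lt_row (show x + (i : ℕ) < x + j from Nat.add_lt_add_left hij x) (by lia)
        have := hlt i
        rw [Fin.lt_def]
        dsimp only
        lia
      · intro i
        obtain ⟨a | a, rfl⟩ := (halvesEquiv x).surjective i
        · have := hlt a
          simp
          lia
        · have := hlt a
          simp
          lia
  rw [← Nat.card_eq_of_bijective φ hφ, Nat.card_sigma]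
  simp only [(finite_and_card_GTPatternWithRow _).2]
  exact sum_coe_sort _ fun f => gtCount (2 * x) (symmRow f)

/-- The height over the upper triangle encoded by a pattern. -/
def upperHeight (g : ℕ → ℕ → ℕ) (i j : ℕ) : ℤ := g (j - i) i - i

/-- The height function on the whole square encoded by a pattern. -/
def heightOf (n M : ℕ) (g : ℕ → ℕ → ℕ) (i j : ℕ) : ℤ :=
  if i ≤ j then upperHeight g i j else M - upperHeight g (n - 1 - i) (n - 1 - j)

section
variable {n M : ℕ} {g : ℕ → ℕ → ℕ}

theorem upperHeight_le_right (hg : IsGTPattern n g) {i j : ℕ} (hij : i ≤ j) (hj : j + 1 < n) :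
    upperHeight g i j ≤ upperHeight g i (j + 1) := by
  have := hg.le (j - i) i (by lia)
  rw [upperHeight, upperHeight, show j + 1 - i = j - i + 1 by lia]
  lia

theorem upperHeight_le_down (hg : IsGTPattern n g) {i j : ℕ} (hij : i + 1 ≤ j) (hj : j < n) :
    upperHeight g i j ≤ upperHeight g (i + 1) j := by
  have := hg.lt (j - (i + 1)) i (by lia)
  rw [upperHeight, upperHeight, show j - i = j - (i + 1) + 1 by lia]
  push_cast
  lia

theorem le_entry (hg : IsGTPattern n g) {t i : ℕ} (h : t + i < n) : i ≤ g t i := by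
  induction i with
  | zero => lia
  | succ i ih =>
    have := hg.le t i (by lia)
    have := hg.lt t i (by lia)
    have := ih (by lia)
    lia

theorem entry_le (hg : IsGTPattern n g) (hs : ∀ i, i < n → g 0 i + g 0 (n - 1 - i) = M + n - 1)
    {t i : ℕ} (h : t + i < n) : g t i ≤ M + i := by
  induction t generalizing i with
  | zero =>
    have := hs i (by lia)
    have := le_entry hg (show 0 + (n - 1 - i) < n by lia)
    lia
  | succ t ih =>
    have := hg.lt t i (by lia)
    have := ih (show t + (i + 1) < n by lia)
    lia

theorem upperHeight_diag
    (hs : ∀ i, i < n → g 0 i + g 0 (n - 1 - i) = M + n - 1) {i : ℕ} (hi : i < n) :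
    upperHeight g i i = M - upperHeight g (n - 1 - i) (n - 1 - i) := by
  have := hs i hi
  simp only [upperHeight, Nat.sub_self]
  lia

theorem heightOf_of_le {i j : ℕ} (hij : i ≤ j) : heightOf n M g i j = upperHeight g i j :=
  if_pos hij

theorem heightOf_of_ge
    (hs : ∀ i, i < n → g 0 i + g 0 (n - 1 - i) = M + n - 1) {i j : ℕ} (hij : j ≤ i) (hi : i < n) :
    heightOf n M g i j = M - upperHeight g (n - 1 - i) (n - 1 - j) := by
  rcases hij.eq_or_lt with rfl | hij
  · rw [heightOf_of_le le_rfl, upperHeight_diag hs hi]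
  · exact if_neg hij.not_ge

theorem heightOf_rev
    (hs : ∀ i, i < n → g 0 i + g 0 (n - 1 - i) = M + n - 1) {i j : ℕ} (hi : i < n) (hj : j < n) :
    heightOf n M g (n - 1 - i) (n - 1 - j) = M - heightOf n M g i j := by
  rcases le_total i j with h | h
  · rw [heightOf_of_le h, heightOf_of_ge hs (by lia) (by lia),
      show n - 1 - (n - 1 - i) = i by lia, show n - 1 - (n - 1 - j) = j by lia]
  · rw [heightOf_of_ge hs h hi, heightOf_of_le (by lia)]
    ring

theorem heightOf_le_right (hg : IsGTPattern n g)
    (hs : ∀ i, i < n → g 0 i + g 0 (n - 1 - i) = M + n - 1) {i j : ℕ} (hi : i < n)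
    (hj : j + 1 < n) : heightOf n M g i j ≤ heightOf n M g i (j + 1) := by
  rcases le_or_gt i j with h | h
  · rw [heightOf_of_le h, heightOf_of_le (by lia)]
    exact upperHeight_le_right hg h hj
  · rw [heightOf_of_ge hs h.le hi, heightOf_of_ge hs h hi]
    have := upperHeight_le_right hg (show n - 1 - i ≤ n - 1 - (j + 1) by lia) (by lia)
    rw [show n - 1 - (j + 1) + 1 = n - 1 - j by lia] at this
    lia

theorem heightOf_le_down (hg : IsGTPattern n g)
    (hs : ∀ i, i < n → g 0 i + g 0 (n - 1 - i) = M + n - 1) {i j : ℕ} (hi : i + 1 < n)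
    (hj : j < n) : heightOf n M g i j ≤ heightOf n M g (i + 1) j := by
  rcases le_or_gt (i + 1) j with h | h
  · rw [heightOf_of_le h, heightOf_of_le (by lia)]
    exact upperHeight_le_down hg h hj
  · rw [heightOf_of_ge hs (by lia) (by lia), heightOf_of_ge hs h.le hi]
    have := upperHeight_le_down hg
      (show n - 1 - (i + 1) + 1 ≤ n - 1 - j by lia) (by lia)
    rw [show n - 1 - (i + 1) + 1 = n - 1 - i by lia] at this
    lia

theorem heightOf_mono (hg : IsGTPattern n g)
    (hs : ∀ i, i < n → g 0 i + g 0 (n - 1 - i) = M + n - 1) {i j i' j' : ℕ} (hii : i ≤ i')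
    (hjj : j ≤ j') (hi : i' < n) (hj : j' < n) : heightOf n M g i j ≤ heightOf n M g i' j' := by
  trans heightOf n M g i' j
  · induction i', hii using Nat.le_induction with
    | base => rfl
    | succ i' h ih => exact (ih (by lia)).trans (heightOf_le_down hg hs hi (hjj.trans_lt hj))
  · induction j', hjj using Nat.le_induction with
    | base => rfl
    | succ j' h ih => exact (ih (by lia)).trans (heightOf_le_right hg hs hi hj)

end

theorem exists_height_of_isLowerSet {M : ℕ} {T : Set (Fin M)} (hT : IsLowerSet T) :
    ∃ h ≤ M, ∀ k : Fin M, k ∈ T ↔ (k : ℕ) + h < M := by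
  classical
  have hex : ∃ c : ℕ, ∀ k : Fin M, c ≤ (k : ℕ) → k ∉ T := ⟨M, fun k hk => absurd k.2 (by lia)⟩
  have hle : Nat.find hex ≤ M := Nat.find_min' hex fun k hk => absurd k.2 (by lia)
  refine ⟨M - Nat.find hex, by lia, fun k => ⟨fun hk => ?_, fun hk => ?_⟩⟩
  · have := mt (Nat.find_spec hex k) (not_not.2 hk)
    lia
  · by_contra hkT
    have := Nat.find_min' hex fun l (hl : (k : ℕ) ≤ l) hlT => hkT (hT (Fin.le_def.2 hl) hlT)
    lia

/-- Self-complementary plane partitions in an `n × n × M` box. -/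
abbrev SelfComplementary (n M : ℕ) : Type :=
  {S : Set (Fin n × Fin n × Fin M) //
    IsLowerSet S ∧ ∀ i j k, (i, j, k) ∈ S ↔ (i.rev, j.rev, k.rev) ∉ S}

theorem card_selfComplementary (n M : ℕ) :
    Nat.card (SelfComplementary n M) = Nat.card (SymmGTPattern n M) := by
  symm
  let φ : SymmGTPattern n M → SelfComplementary n M := fun g =>
    ⟨{p | ((p.2.2 : ℕ) : ℤ) + heightOf n M g.1 p.1 p.2.1 < M}, by
      rintro ⟨i, j, k⟩ ⟨i', j', k'⟩ ⟨hi, hj, hk⟩ h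
      have h1 := heightOf_mono g.2.1 g.2.2 (Fin.le_def.1 hi) (Fin.le_def.1 hj) i.2 j.2
      have h2 := Fin.le_def.1 hk
      simp only [Set.mem_ofPred_eq] at h h1 h2 ⊢
      omega, by
      intro i j k
      have h := heightOf_rev g.2.2 i.2 j.2
      simp only [Set.mem_ofPred_eq, Fin.val_rev]
      rw [show n - ((i : ℕ) + 1) = n - 1 - i by lia, show n - ((j : ℕ) + 1) = n - 1 - j by lia, h]
      omega⟩
  refine Nat.card_eq_of_bijective φ ⟨?_, ?_⟩
  · rintro ⟨g, hg, hs⟩ ⟨g', hg', hs'⟩ h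
    have h : {p : Fin n × Fin n × Fin M | ((p.2.2 : ℕ) : ℤ) + heightOf n M g p.1 p.2.1 < M} =
      {p | ((p.2.2 : ℕ) : ℤ) + heightOf n M g' p.1 p.2.1 < M} := congrArg Subtype.val h
    refine Subtype.ext (funext fun t => funext fun i => ?_)
    by_cases hti : t + i < n
    · have h1 := le_entry hg hti
      have h2 := le_entry hg' hti
      have h3 := entry_le hg hs hti
      have h4 := entry_le hg' hs' hti
      have key : ∀ k < M, k + (g t i - i) < M ↔ k + (g' t i - i) < M := by
        intro k hk
        have := Set.ext_iff.1 h (⟨i, by lia⟩, ⟨i + t, by lia⟩, ⟨k, hk⟩)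
        simp only [Set.mem_ofPred_eq, heightOf_of_le (Nat.le_add_right i t), upperHeight,
          Nat.add_sub_cancel_left] at this
        lia
      have h5 := key (M - (g t i - i))
      have h6 := key (M - (g' t i - i))
      show g t i = g' t i
      lia
    · exact (hg.eq_zero t i (by lia)).trans (hg'.eq_zero t i (by lia)).symm
  · rintro ⟨S, hS, hc⟩
    have hex : ∀ i j : Fin n, ∃ h ≤ M, ∀ k : Fin M, (i, j, k) ∈ S ↔ (k : ℕ) + h < M :=
      fun i j => exists_height_of_isLowerSet (T := {k | (i, j, k) ∈ S})
        fun k l hkl hk => hS (by exact ⟨le_rfl, le_rfl, hkl⟩) hk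
    choose h hM hmem using hex
    have hmono : ∀ {i j i' j' : Fin n}, i ≤ i' → j ≤ j' → h i j ≤ h i' j' := by
      intro i j i' j' hi hj
      by_contra! hlt
      have h1 := hM i j
      have h2 := (hmem i' j' ⟨M - h i j, by lia⟩).2 (by simp only; lia)
      have h3 := (hmem i j _).1 (hS (by exact ⟨hi, hj, le_rfl⟩) h2)
      simp only at h3
      lia
    have hrev : ∀ i j : Fin n, h i j + h i.rev j.rev = M := by
      intro i j
      have h1 := hM i j
      have h2 := hM i.rev j.rev
      have key : ∀ k, k < M → (k + h i j < M ↔ ¬ (M - 1 - k + h i.rev j.rev < M)) := by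
        intro k hk
        have := hc i j ⟨k, hk⟩
        rw [hmem, hmem, Fin.val_rev] at this
        rw [this, show M - 1 - k = M - (k + 1) by lia]
      have h3 := key (M - h i j)
      have h4 := key (M - h i j - 1)
      lia
    let g : ℕ → ℕ → ℕ := fun t i =>
      if hti : t + i < n then h ⟨i, by lia⟩ ⟨i + t, by lia⟩ + i else 0
    have hgpos : ∀ {t i} (hti : t + i < n), g t i = h ⟨i, by lia⟩ ⟨i + t, by lia⟩ + i :=
      fun hti => dif_pos hti
    have hg : IsGTPattern n g := by
      refine ⟨fun t i hti => dif_neg (by lia), fun t i hti => ?_, fun t i hti => ?_⟩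
      · rw [hgpos (by lia), hgpos (by lia)]
        exact Nat.add_le_add_right (hmono le_rfl (Fin.le_def.2 (by simp only; lia))) i
      · rw [hgpos (by lia), hgpos (by lia)]
        exact Nat.lt_succ_of_le <| Nat.add_le_add_right
          (hmono (Fin.le_def.2 (by simp only; lia)) (Fin.le_def.2 (by simp only; lia))) i
    have hs : ∀ i, i < n → g 0 i + g 0 (n - 1 - i) = M + n - 1 := by
      intro i hi
      rw [hgpos (by lia), hgpos (by lia)]
      have := hrev ⟨i, hi⟩ ⟨i, hi⟩
      simp only [Fin.rev, show n - (i + 1) = n - 1 - i by lia] at this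
      simp only [add_zero]
      lia
    have hH : ∀ i j : Fin n, heightOf n M g i j = h i j := by
      have hup : ∀ i j : Fin n, i ≤ j → heightOf n M g i j = h i j := by
        intro i j hij
        have hij' := Fin.le_def.1 hij
        rw [heightOf_of_le hij', upperHeight, hgpos (by lia)]
        simp [Nat.add_sub_cancel' hij']
      intro i j
      rcases le_total i j with hij | hij
      · exact hup i j hij
      · have h1 := heightOf_rev hs i.2 j.2
        have h2 := hup i.rev j.rev (Fin.rev_le_rev.2 hij)
        have h3 := hrev i j
        rw [Fin.val_rev, Fin.val_rev, show n - ((i : ℕ) + 1) = n - 1 - i by lia,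
          show n - ((j : ℕ) + 1) = n - 1 - j by lia] at h2
        lia
    refine ⟨⟨g, hg, hs⟩, Subtype.ext (Set.ext ?_)⟩
    rintro ⟨i, j, k⟩
    simp only [φ, Set.mem_ofPred_eq, hH, hmem]
    omega

theorem SC_even_even (x y : ℕ) (hx : 0 < x) (hy : 0 < y) :
    (Nat.card {S : Set (Fin (2 * x) × Fin (2 * x) × Fin (2 * y)) //
        IsLowerSet S ∧
        (∀ i j k, (i, j, k) ∈ S ↔ (i.rev, j.rev, k.rev) ∉ S)} : ℚ) =
      PP x x y ^ 2 := by
  have hfact : (∏ i ∈ range (2 * x), (i.factorial : ℚ)) ≠ 0 :=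
    prod_ne_zero_iff.2 fun i _ => Nat.cast_ne_zero.2 i.factorial_ne_zero
  refine mul_right_cancel₀ hfact ?_
  rw [← prod_moments_eq x y hx, ← sum_strictMono_vandermonde_sq (by lia),
    card_selfComplementary, card_SymmGTPattern rfl (show x + y - 1 + 1 = x + y by lia),
    Nat.cast_sum, sum_mul]
  exact sum_congr rfl fun f hf => gtCount_symmRow (mem_filter.1 hf).2
end
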